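/- Let P(λ) = Σ_{i=0}^k λ^i A_i be an m×n matrix polynomial of grade k with m ≥ n and r = nrank P(λ). Let L(λ) ∈ 𝕃₁(P) with nonzero right ansatz vector v ∈ F^k have full Z-rank, and let L_t(λ) = D L(λ) be the pencil obtained by trimming L(λ) with respect to a nonsingular M (with Mv = αe₁, α ≠ 0) and an admissible D ∈ F^{(m+(k−1)n)×km}. Then L_t(λ) is a strong linearization of P(λ) such that: (a) every minimal basis of N_r(L_t) is of the form {Λ_k(λ)⊗x₁(λ), …, Λ_k(λ)⊗x_{n−r}(λ)} where {x₁(λ), …, x_{n−r}(λ)} is a minimal basis of N_r(P); (b) the right minimal indices of L_t(λ) are those of P(λ) shifted by k−1; (c) every minimal basis of N_l(P) is of the form {(v^T⊗I_m)D^T y₁(λ), …, (v^T⊗I_m)D^T y_{m−r}(λ)} where {y₁(λ), …, y_{m−r}(λ)} is a minimal basis of N_l(L_t); (d) the left minimal indices of P(λ) are equal to those of L_t(λ). -/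

import Mathlib

noncomputable section

open Polynomial Matrix

namespace GLin

variable {F : Type*} [RCLike F]

/-! ### Matrix polynomials and pencils -/

/-- The matrix polynomial `P(λ) = ∑_{i=0}^k λ^i A_i` determined by its
coefficient matrices `A_0, …, A_k` (grade `k`). -/
def matPoly {k m n : ℕ} (A : Fin (k + 1) → Matrix (Fin m) (Fin n) F) :
    Matrix (Fin m) (Fin n) F[X] :=
  Matrix.of fun r c => ∑ i : Fin (k + 1), Polynomial.C (A i r c) * Polynomial.X ^ (i : ℕ)

/-- The matrix pencil `L(λ) = λ X + Y`. -/
def pencil {ρ γ : Type*} (Xc Yc : Matrix ρ γ F) : Matrix ρ γ F[X] :=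
  Matrix.of fun i j => Polynomial.C (Xc i j) * Polynomial.X + Polynomial.C (Yc i j)

/-- `Λ_k(λ) ⊗ I_n` where `Λ_k(λ) = (λ^{k-1}, …, λ, 1)ᵀ`. -/
def Lam (F : Type*) [RCLike F] (k n : ℕ) : Matrix (Fin k × Fin n) (Fin n) F[X] :=
  Matrix.of fun p c => if p.2 = c then Polynomial.X ^ (k - 1 - (p.1 : ℕ)) else 0

/-- `Λ_k(λ)ᵀ ⊗ I_m`. -/
def LamRow (F : Type*) [RCLike F] (k m : ℕ) : Matrix (Fin m) (Fin k × Fin m) F[X] :=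
  Matrix.of fun r p => if r = p.2 then Polynomial.X ^ (k - 1 - (p.1 : ℕ)) else 0

/-- `v ⊗ P(λ)`. -/
def vkron {k m n : ℕ} (v : Fin k → F) (P : Matrix (Fin m) (Fin n) F[X]) :
    Matrix (Fin k × Fin m) (Fin n) F[X] :=
  Matrix.of fun p c => Polynomial.C (v p.1) * P p.2 c

/-- `wᵀ ⊗ P(λ)`. -/
def wkron {k m n : ℕ} (w : Fin k → F) (P : Matrix (Fin m) (Fin n) F[X]) :
    Matrix (Fin m) (Fin k × Fin n) F[X] :=
  Matrix.of fun r q => Polynomial.C (w q.1) * P r q.2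

/-- The defining identity of `𝕃₁(P)`: `L(λ)(Λ_k(λ) ⊗ I_n) = v ⊗ P(λ)`. -/
def RightAnsatz {k m n : ℕ} (P : Matrix (Fin m) (Fin n) F[X])
    (L : Matrix (Fin k × Fin m) (Fin k × Fin n) F[X]) (v : Fin k → F) : Prop :=
  L * Lam F k n = vkron v P

/-- The defining identity of `𝕃₂(P)`: `(Λ_k(λ)ᵀ ⊗ I_m) L(λ) = wᵀ ⊗ P(λ)`. -/
def LeftAnsatz {k m n : ℕ} (P : Matrix (Fin m) (Fin n) F[X])
    (L : Matrix (Fin k × Fin m) (Fin k × Fin n) F[X]) (w : Fin k → F) : Prop :=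
  LamRow F k m * L = wkron w P

/-- The vector `α e₁ ∈ F^k`. -/
def e1 {k : ℕ} (α : F) : Fin k → F := fun i => if (i : ℕ) = 0 then α else 0

/-- `M ⊗ I_m`. -/
def kronId {k m : ℕ} (M : Matrix (Fin k) (Fin k) F) :
    Matrix (Fin k × Fin m) (Fin k × Fin m) F :=
  Matrix.of fun p q => if p.2 = q.2 then M p.1 q.1 else 0

/-! ### (strong) g-linearizations -/

/-- `diag(P(λ), I_{k-1} ⊗ I_{m,n})`. -/
def glinTarget {k m n : ℕ} (P : Matrix (Fin m) (Fin n) F[X]) :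
    Matrix (Fin k × Fin m) (Fin k × Fin n) F[X] :=
  Matrix.of fun p q =>
    if p.1 = q.1 then
      (if (p.1 : ℕ) = 0 then P p.2 q.2 else if (p.2 : ℕ) = (q.2 : ℕ) then 1 else 0)
    else 0

/-- A `km × kn` pencil (or matrix polynomial) `L` is a g-linearization of the `m × n`
matrix polynomial `P` of grade `k` if `E(λ) L(λ) G(λ) = diag(P(λ), I_{k-1} ⊗ I_{m,n})`
for unimodular `E`, `G`. -/
def IsGLin {k m n : ℕ} (P : Matrix (Fin m) (Fin n) F[X])
    (L : Matrix (Fin k × Fin m) (Fin k × Fin n) F[X]) : Prop :=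
  ∃ (E : Matrix (Fin k × Fin m) (Fin k × Fin m) F[X])
    (G : Matrix (Fin k × Fin n) (Fin k × Fin n) F[X]),
      IsUnit E.det ∧ IsUnit G.det ∧ E * L * G = glinTarget P

/-- grade-`N` reversal `rev_N P(λ) = λ^N P(1/λ)`, entrywise. -/
def revMat {ρ γ : Type*} (N : ℕ) (P : Matrix ρ γ F[X]) : Matrix ρ γ F[X] :=
  P.map fun p => Polynomial.reflect N p

/-- Strong g-linearization of the grade-`k` matrix polynomial with coefficients `A`. -/
def IsStrongGLin {k m n : ℕ} (A : Fin (k + 1) → Matrix (Fin m) (Fin n) F)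
    (L : Matrix (Fin k × Fin m) (Fin k × Fin n) F[X]) : Prop :=
  IsGLin (matPoly A) L ∧ IsGLin (revMat k (matPoly A)) (revMat 1 L)

/-! ### linearizations (rectangular, of size `(m+s) × (n+s)`) -/

/-- A matrix polynomial `L` (indexed by arbitrary finite types of cardinalities
`m + s` and `n + s`) is a linearization of `P` if, after identifying the index types
with `Fin m ⊕ Fin s` and `Fin n ⊕ Fin s`, one has `E(λ) L(λ) G(λ) = diag(P(λ), I_s)`
for unimodular `E`, `G`. -/
def IsLin {m n : ℕ} (s : ℕ) (P : Matrix (Fin m) (Fin n) F[X])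
    {ρ γ : Type*} [Fintype ρ] [DecidableEq ρ] [Fintype γ] [DecidableEq γ]
    (L : Matrix ρ γ F[X]) : Prop :=
  ∃ (er : ρ ≃ (Fin m ⊕ Fin s)) (ec : γ ≃ (Fin n ⊕ Fin s))
    (E : Matrix (Fin m ⊕ Fin s) (Fin m ⊕ Fin s) F[X])
    (G : Matrix (Fin n ⊕ Fin s) (Fin n ⊕ Fin s) F[X]),
      IsUnit E.det ∧ IsUnit G.det ∧
        E * Matrix.reindex er ec L * G = Matrix.fromBlocks P 0 0 1

/-- Strong linearization of the grade-`k` matrix polynomial with coefficients `A`. -/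
def IsStrongLin {k m n : ℕ} (s : ℕ) (A : Fin (k + 1) → Matrix (Fin m) (Fin n) F)
    {ρ γ : Type*} [Fintype ρ] [DecidableEq ρ] [Fintype γ] [DecidableEq γ]
    (L : Matrix ρ γ F[X]) : Prop :=
  IsLin s (matPoly A) L ∧ IsLin s (revMat k (matPoly A)) (revMat 1 L)

/-! ### shifted sums -/

/-- Column shifted sum `X ⊞→ Y`. -/
def colShiftSum {k m n : ℕ} (Xc Yc : Matrix (Fin k × Fin m) (Fin k × Fin n) F) :
    Matrix (Fin k × Fin m) (Fin (k + 1) × Fin n) F :=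
  Matrix.of fun p q =>
    (if h : (q.1 : ℕ) < k then Xc p (⟨(q.1 : ℕ), h⟩, q.2) else 0) +
    (if h : 0 < (q.1 : ℕ) then
        Yc p (⟨(q.1 : ℕ) - 1, by have := q.1.isLt; omega⟩, q.2)
      else 0)

/-- Row shifted sum `X ⊞↓ Y`. -/
def rowShiftSum {k m n : ℕ} (Xc Yc : Matrix (Fin k × Fin m) (Fin k × Fin n) F) :
    Matrix (Fin (k + 1) × Fin m) (Fin k × Fin n) F :=
  Matrix.of fun p q =>
    (if h : (p.1 : ℕ) < k then Xc (⟨(p.1 : ℕ), h⟩, p.2) q else 0) +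
    (if h : 0 < (p.1 : ℕ) then
        Yc (⟨(p.1 : ℕ) - 1, by have := p.1.isLt; omega⟩, p.2) q
      else 0)

/-! ### the parametrization of `𝕃₁(P)` and `𝕃₂(P)` -/

/-- `X = [v ⊗ A_k ∣ -W]`. -/
def L1X {k m n : ℕ} (A : Fin (k + 1) → Matrix (Fin m) (Fin n) F) (v : Fin k → F)
    (W : Matrix (Fin k × Fin m) (Fin (k - 1) × Fin n) F) :
    Matrix (Fin k × Fin m) (Fin k × Fin n) F :=
  Matrix.of fun p q =>
    if h : (q.1 : ℕ) = 0 then v p.1 * A (Fin.last k) p.2 q.2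
    else -W p (⟨(q.1 : ℕ) - 1, by have := q.1.isLt; omega⟩, q.2)

/-- `Y = [W + v ⊗ [A_{k-1} ⋯ A_1] ∣ v ⊗ A_0]`. -/
def L1Y {k m n : ℕ} (A : Fin (k + 1) → Matrix (Fin m) (Fin n) F) (v : Fin k → F)
    (W : Matrix (Fin k × Fin m) (Fin (k - 1) × Fin n) F) :
    Matrix (Fin k × Fin m) (Fin k × Fin n) F :=
  Matrix.of fun p q =>
    if h : (q.1 : ℕ) < k - 1 then
      W p (⟨(q.1 : ℕ), h⟩, q.2) + v p.1 * A (⟨k - 1 - (q.1 : ℕ), by omega⟩) p.2 q.2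
    else v p.1 * A 0 p.2 q.2

/-- `X = [wᵀ ⊗ A_k ; -Ŵ]`. -/
def L2X {k m n : ℕ} (A : Fin (k + 1) → Matrix (Fin m) (Fin n) F) (w : Fin k → F)
    (W : Matrix (Fin (k - 1) × Fin m) (Fin k × Fin n) F) :
    Matrix (Fin k × Fin m) (Fin k × Fin n) F :=
  Matrix.of fun p q =>
    if h : (p.1 : ℕ) = 0 then w q.1 * A (Fin.last k) p.2 q.2
    else -W (⟨(p.1 : ℕ) - 1, by have := p.1.isLt; omega⟩, p.2) q

/-- `Y = [Ŵ + wᵀ ⊗ [A_{k-1}ᵀ ⋯ A_1ᵀ]ᵀ ; wᵀ ⊗ A_0]`. -/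
def L2Y {k m n : ℕ} (A : Fin (k + 1) → Matrix (Fin m) (Fin n) F) (w : Fin k → F)
    (W : Matrix (Fin (k - 1) × Fin m) (Fin k × Fin n) F) :
    Matrix (Fin k × Fin m) (Fin k × Fin n) F :=
  Matrix.of fun p q =>
    if h : (p.1 : ℕ) < k - 1 then
      W (⟨(p.1 : ℕ), h⟩, p.2) q + w q.1 * A (⟨k - 1 - (p.1 : ℕ), by omega⟩) p.2 q.2
    else w q.1 * A 0 p.2 q.2

/-! ### block structure and `Z`-matrices -/

/-- Assemble a `km × kn` matrix from blocks with row split `m + (k-1)m` and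
column split `n + (k-1)n`. -/
def blk {k m n : ℕ} (TL : Matrix (Fin m) (Fin n) F)
    (TR : Matrix (Fin m) (Fin (k - 1) × Fin n) F)
    (BL : Matrix (Fin (k - 1) × Fin m) (Fin n) F)
    (BR : Matrix (Fin (k - 1) × Fin m) (Fin (k - 1) × Fin n) F) :
    Matrix (Fin k × Fin m) (Fin k × Fin n) F :=
  Matrix.of fun p q =>
    if hp : (p.1 : ℕ) = 0 then
      if hq : (q.1 : ℕ) = 0 then TL p.2 q.2
      else TR p.2 (⟨(q.1 : ℕ) - 1, by have := q.1.isLt; omega⟩, q.2)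
    else
      if hq : (q.1 : ℕ) = 0 then
        BL (⟨(p.1 : ℕ) - 1, by have := p.1.isLt; omega⟩, p.2) q.2
      else
        BR (⟨(p.1 : ℕ) - 1, by have := p.1.isLt; omega⟩, p.2)
          (⟨(q.1 : ℕ) - 1, by have := q.1.isLt; omega⟩, q.2)

/-- Assemble `[[Y₁₁, T],[Z, 0]]`, row split `m + (k-1)m`, column split `(k-1)n + n`. -/
def blkY1 {k m n : ℕ} (Y11 : Matrix (Fin m) (Fin (k - 1) × Fin n) F)
    (T : Matrix (Fin m) (Fin n) F)
    (Z : Matrix (Fin (k - 1) × Fin m) (Fin (k - 1) × Fin n) F) :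
    Matrix (Fin k × Fin m) (Fin k × Fin n) F :=
  Matrix.of fun p q =>
    if hp : (p.1 : ℕ) = 0 then
      if hq : (q.1 : ℕ) < k - 1 then Y11 p.2 (⟨(q.1 : ℕ), hq⟩, q.2) else T p.2 q.2
    else
      if hq : (q.1 : ℕ) < k - 1 then
        Z (⟨(p.1 : ℕ) - 1, by have := p.1.isLt; omega⟩, p.2) (⟨(q.1 : ℕ), hq⟩, q.2)
      else 0

/-- Assemble `[[Y₁₁, Z],[T, 0]]`, row split `(k-1)m + m`, column split `n + (k-1)n`. -/
def blkY2 {k m n : ℕ} (Y11 : Matrix (Fin (k - 1) × Fin m) (Fin n) F)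
    (Z : Matrix (Fin (k - 1) × Fin m) (Fin (k - 1) × Fin n) F)
    (T : Matrix (Fin m) (Fin n) F) :
    Matrix (Fin k × Fin m) (Fin k × Fin n) F :=
  Matrix.of fun p q =>
    if hp : (p.1 : ℕ) < k - 1 then
      if hq : (q.1 : ℕ) = 0 then Y11 (⟨(p.1 : ℕ), hp⟩, p.2) q.2
      else Z (⟨(p.1 : ℕ), hp⟩, p.2) (⟨(q.1 : ℕ) - 1, by have := q.1.isLt; omega⟩, q.2)
    else
      if hq : (q.1 : ℕ) = 0 then T p.2 q.2 else 0

/-- The `Z`-matrix of `L = λX + Y ∈ 𝕃₁(P)` with respect to `M`: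
the lower-left `(k-1)m × (k-1)n` block of `(M ⊗ I_m) Y`. -/
def Zmat1 {k m n : ℕ} (M : Matrix (Fin k) (Fin k) F)
    (Yc : Matrix (Fin k × Fin m) (Fin k × Fin n) F) :
    Matrix (Fin (k - 1) × Fin m) (Fin (k - 1) × Fin n) F :=
  Matrix.of fun p q =>
    (kronId M * Yc : Matrix (Fin k × Fin m) (Fin k × Fin n) F)
      (⟨(p.1 : ℕ) + 1, by have := p.1.isLt; omega⟩, p.2)
      (⟨(q.1 : ℕ), by have := q.1.isLt; omega⟩, q.2)

/-- The `Z`-matrix of `L = λX + Y ∈ 𝕃₂(P)` with respect to `M̂`: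
the upper-right `(k-1)m × (k-1)n` block of `Y (M̂ᵀ ⊗ I_n)`. -/
def Zmat2 {k m n : ℕ} (M : Matrix (Fin k) (Fin k) F)
    (Yc : Matrix (Fin k × Fin m) (Fin k × Fin n) F) :
    Matrix (Fin (k - 1) × Fin m) (Fin (k - 1) × Fin n) F :=
  Matrix.of fun p q =>
    (Yc * kronId Mᵀ : Matrix (Fin k × Fin m) (Fin k × Fin n) F)
      (⟨(p.1 : ℕ), by have := p.1.isLt; omega⟩, p.2)
      (⟨(q.1 : ℕ) + 1, by have := q.1.isLt; omega⟩, q.2)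

/-- `L = λX + Y ∈ 𝕃₁(P)` with right ansatz vector `v` has full `Z`-rank. -/
def FullZrank1 {k m n : ℕ} (Yc : Matrix (Fin k × Fin m) (Fin k × Fin n) F)
    (v : Fin k → F) : Prop :=
  ∃ (M : Matrix (Fin k) (Fin k) F) (α : F),
    IsUnit M ∧ α ≠ 0 ∧ M.mulVec v = e1 α ∧ (Zmat1 M Yc).rank = (k - 1) * n

/-- `L = λX + Y ∈ 𝕃₂(P)` with left ansatz vector `w` has full `Z`-rank. -/
def FullZrank2 {k m n : ℕ} (Yc : Matrix (Fin k × Fin m) (Fin k × Fin n) F)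
    (w : Fin k → F) : Prop :=
  ∃ (M : Matrix (Fin k) (Fin k) F) (α : F),
    IsUnit M ∧ α ≠ 0 ∧ M.mulVec w = e1 α ∧ (Zmat2 M Yc).rank = (k - 1) * m

/-! ### null spaces, minimal bases and minimal indices over `F(λ)` -/

/-- A matrix polynomial viewed as a matrix over the field of rational functions. -/
def matRF {ρ γ : Type*} (P : Matrix ρ γ F[X]) : Matrix ρ γ (RatFunc F) :=
  P.map (algebraMap F[X] (RatFunc F))

/-- The right null space `N_r(P) = {x(λ) : P(λ) x(λ) ≡ 0}` over `F(λ)`. -/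
def Nr {ρ γ : Type*} [Fintype γ] (P : Matrix ρ γ F[X]) :
    Submodule (RatFunc F) (γ → RatFunc F) :=
  LinearMap.ker (Matrix.mulVecLin (matRF P))

/-- The left null space `N_l(P) = {y(λ) : y(λ)ᵀ P(λ) ≡ 0}` over `F(λ)`. -/
def Nl {ρ γ : Type*} [Fintype ρ] (P : Matrix ρ γ F[X]) :
    Submodule (RatFunc F) (ρ → RatFunc F) :=
  Nr Pᵀ

/-- The normal rank of a matrix polynomial: its rank over `F(λ)`. -/
def nrank {ρ γ : Type*} [Fintype γ] (P : Matrix ρ γ F[X]) : ℕ :=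
  (matRF P).rank

/-- The rational vector determined by a vector polynomial. -/
def polyVec {γ : Type*} (x : γ → F[X]) : γ → RatFunc F :=
  fun i => algebraMap F[X] (RatFunc F) (x i)

/-- A rational vector is a vector polynomial if all its entries are polynomials. -/
def IsVecPoly {γ : Type*} (x : γ → RatFunc F) : Prop :=
  ∃ p : γ → F[X], x = polyVec p

/-- The degree of a vector polynomial: the greatest degree of its components. -/
def polyVecDeg {γ : Type*} [Fintype γ] (x : γ → F[X]) : ℕ :=
  Finset.univ.sup fun i => (x i).natDegree

/-- A polynomial basis of the subspace `V` of `F(λ)^γ`. -/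
def IsPolyBasis {γ ι : Type*} [Fintype γ]
    (V : Submodule (RatFunc F) (γ → RatFunc F)) (b : ι → γ → F[X]) : Prop :=
  LinearIndependent (RatFunc F) (fun i => polyVec (b i)) ∧
    Submodule.span (RatFunc F) (Set.range fun i => polyVec (b i)) = V

/-- A minimal basis of `V`: a polynomial basis of least order (sum of degrees). -/
def IsMinimalBasis {γ ι : Type*} [Fintype γ] [Fintype ι]
    (V : Submodule (RatFunc F) (γ → RatFunc F)) (b : ι → γ → F[X]) : Prop :=
  IsPolyBasis V b ∧
    ∀ (d : ℕ) (b' : Fin d → γ → F[X]), IsPolyBasis V b' →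
      ∑ i, polyVecDeg (b i) ≤ ∑ i, polyVecDeg (b' i)

/-- `ε` is the list of minimal indices of `V`: some minimal basis of `V` has
`ε` as its list of degrees. -/
def HasMinIndices {γ : Type*} [Fintype γ]
    (V : Submodule (RatFunc F) (γ → RatFunc F)) {d : ℕ} (ε : Fin d → ℕ) : Prop :=
  ∃ b : Fin d → γ → F[X], IsMinimalBasis V b ∧ ∀ i, polyVecDeg (b i) = ε i

/-- `Λ_k(λ) ⊗ x(λ)`. -/
def lamTensor {n : ℕ} (k : ℕ) (x : Fin n → RatFunc F) : Fin k × Fin n → RatFunc F :=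
  fun p => algebraMap F[X] (RatFunc F) (Polynomial.X ^ (k - 1 - (p.1 : ℕ))) * x p.2

/-- The matrix `vᵀ ⊗ I_m` over `F(λ)`; `𝓛_v(y) = (vproj v).mulVec y`. -/
def vproj {k m : ℕ} (v : Fin k → F) : Matrix (Fin m) (Fin k × Fin m) (RatFunc F) :=
  Matrix.of fun r p =>
    if r = p.2 then algebraMap F[X] (RatFunc F) (Polynomial.C (v p.1)) else 0

/-- `(vᵀ ⊗ I_m) y` at the level of vector polynomials. -/
def LvPoly {k m : ℕ} (v : Fin k → F) (y : Fin k × Fin m → F[X]) : Fin m → F[X] :=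
  fun r => ∑ i : Fin k, Polynomial.C (v i) * y (i, r)

/-- The rational subspace spanned by the rows of a matrix polynomial. -/
def rowSpan {ρ γ : Type*} [Fintype γ] (B : Matrix ρ γ F[X]) :
    Submodule (RatFunc F) (γ → RatFunc F) :=
  Submodule.span (RatFunc F) (Set.range fun i => polyVec (B i))

/-- A matrix polynomial is a minimal basis if its rows form a minimal basis of the
rational subspace they span. -/
def IsMinimalBasisMat {ρ γ : Type*} [Fintype ρ] [Fintype γ] (B : Matrix ρ γ F[X]) : Prop :=
  IsMinimalBasis (rowSpan B) (fun i => B i)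

/-- Dual minimal bases: `B ∈ F[λ]^{n₁×n}`, `C ∈ F[λ]^{n₂×n}` minimal bases with
`n₁ + n₂ = n` and `B Cᵀ = 0`. -/
def DualMinBases {ρ ρ' γ : Type*} [Fintype ρ] [Fintype ρ'] [Fintype γ]
    (B : Matrix ρ γ F[X]) (Cm : Matrix ρ' γ F[X]) : Prop :=
  IsMinimalBasisMat B ∧ IsMinimalBasisMat Cm ∧
    Fintype.card ρ + Fintype.card ρ' = Fintype.card γ ∧ B * Cmᵀ = 0

/-! ### norms, singular values -/

/-- Square of the Frobenius norm of a constant matrix. -/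
def frobSq {ρ γ : Type*} [Fintype ρ] [Fintype γ] (Ac : Matrix ρ γ F) : ℝ :=
  ∑ i, ∑ j, ‖Ac i j‖ ^ 2

/-- `‖λX + Y‖_F = sqrt(‖X‖_F² + ‖Y‖_F²)`. -/
def penFrob {ρ γ : Type*} [Fintype ρ] [Fintype γ] (Xc Yc : Matrix ρ γ F) : ℝ :=
  Real.sqrt (frobSq Xc + frobSq Yc)

/-- `‖P‖_F = sqrt(∑ ‖A_i‖_F²)` for `P(λ) = ∑ λ^i A_i`. -/
def famFrob {k m n : ℕ} (A : Fin (k + 1) → Matrix (Fin m) (Fin n) F) : ℝ :=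
  Real.sqrt (∑ i, frobSq (A i))

/-- `‖P‖_F` for a matrix polynomial of grade `g`. -/
def mpolyFrob {ρ γ : Type*} [Fintype ρ] [Fintype γ] (g : ℕ) (P : Matrix ρ γ F[X]) : ℝ :=
  Real.sqrt (∑ i, ∑ j, ∑ d ∈ Finset.range (g + 1), ‖(P i j).coeff d‖ ^ 2)

/-- Square of the Euclidean norm of a vector. -/
def vecNormSq {ι : Type*} [Fintype ι] (x : ι → F) : ℝ := ∑ i, ‖x i‖ ^ 2

/-- The smallest singular value of a matrix. -/
def sigmaMin {ρ γ : Type*} [Fintype ρ] [Fintype γ] (Ac : Matrix ρ γ F) : ℝ :=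
  if Fintype.card γ ≤ Fintype.card ρ then
    sInf {r : ℝ | ∃ x : γ → F, vecNormSq x = 1 ∧ r = Real.sqrt (vecNormSq (Ac.mulVec x))}
  else
    sInf {r : ℝ | ∃ y : ρ → F, vecNormSq y = 1 ∧ r = Real.sqrt (vecNormSq (Acᴴ.mulVec y))}

/-- The spectral norm (2-norm) of a matrix. -/
def norm2 {ρ γ : Type*} [Fintype ρ] [Fintype γ] (Ac : Matrix ρ γ F) : ℝ :=
  sSup {r : ℝ | ∃ x : γ → F, vecNormSq x = 1 ∧ r = Real.sqrt (vecNormSq (Ac.mulVec x))}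

/-- `κ₂(D) = ‖D‖₂ ‖D⁻¹‖₂`. -/
def cond2 {ρ : Type*} [Fintype ρ] [DecidableEq ρ] (Dc : Matrix ρ ρ F) : ℝ :=
  norm2 Dc * norm2 Dc⁻¹

/-! ### pencils used in the backward error analysis -/

/-- `B(λ) = λ [0 ∣ -R̃] + [R̃ ∣ 0]`, i.e. `R̃ (H_{k-1}(λ) ⊗ I_n)` up to sign conventions. -/
def Bpencil {k n : ℕ} (R : Matrix (Fin (k - 1) × Fin n) (Fin (k - 1) × Fin n) F) :
    Matrix (Fin (k - 1) × Fin n) (Fin k × Fin n) F[X] :=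
  Matrix.of fun p q =>
    (if h : (q.1 : ℕ) < k - 1 then Polynomial.C (R p (⟨(q.1 : ℕ), h⟩, q.2)) else 0) +
    (if h : 0 < (q.1 : ℕ) then
        Polynomial.X *
          Polynomial.C (-R p (⟨(q.1 : ℕ) - 1, by have := q.1.isLt; omega⟩, q.2))
      else 0)

/-- The coefficient of `λ` in `H_{k-1}(λ) ⊗ I_n`. -/
def Hlam (F : Type*) [RCLike F] (k n : ℕ) :
    Matrix (Fin (k - 1) × Fin n) (Fin k × Fin n) F :=
  Matrix.of fun p q => if p.2 = q.2 ∧ (q.1 : ℕ) = (p.1 : ℕ) + 1 then 1 else 0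

/-- The constant coefficient of `H_{k-1}(λ) ⊗ I_n`. -/
def Hconst (F : Type*) [RCLike F] (k n : ℕ) :
    Matrix (Fin (k - 1) × Fin n) (Fin k × Fin n) F :=
  Matrix.of fun p q => if p.2 = q.2 ∧ (q.1 : ℕ) = (p.1 : ℕ) then -1 else 0

/-- The convolution matrix `C_j(λ Xc + Yc)` of a pencil, with `j+1` block columns. -/
def convPencil {ρ γ : Type*} (Xc Yc : Matrix ρ γ F) (j : ℕ) :
    Matrix (Fin (j + 2) × ρ) (Fin (j + 1) × γ) F :=
  Matrix.of fun r c =>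
    if (r.1 : ℕ) = (c.1 : ℕ) then Xc r.2 c.2
    else if (r.1 : ℕ) = (c.1 : ℕ) + 1 then Yc r.2 c.2 else 0

/-- λ-coefficient of the trimmed pencil `L̂_t(λ)`:
`[[α A_k, X₁₂],[0, -R̃]]` with row split `m + (k-1)n`. -/
def LtX {k m n : ℕ} (α : F) (Ak : Matrix (Fin m) (Fin n) F)
    (X12 : Matrix (Fin m) (Fin (k - 1) × Fin n) F)
    (R : Matrix (Fin (k - 1) × Fin n) (Fin (k - 1) × Fin n) F) :
    Matrix (Fin m ⊕ (Fin (k - 1) × Fin n)) (Fin k × Fin n) F :=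
  Matrix.of fun s q =>
    Sum.elim
      (fun r => if h : (q.1 : ℕ) = 0 then α * Ak r q.2
        else X12 r (⟨(q.1 : ℕ) - 1, by have := q.1.isLt; omega⟩, q.2))
      (fun p => if h : (q.1 : ℕ) = 0 then 0
        else -R p (⟨(q.1 : ℕ) - 1, by have := q.1.isLt; omega⟩, q.2)) s

/-- Constant coefficient of the trimmed pencil `L̂_t(λ)`:
`[[Y₁₁, α A₀],[R̃, 0]]` with row split `m + (k-1)n`. -/
def LtY {k m n : ℕ} (α : F) (A0 : Matrix (Fin m) (Fin n) F)
    (Y11 : Matrix (Fin m) (Fin (k - 1) × Fin n) F)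
    (R : Matrix (Fin (k - 1) × Fin n) (Fin (k - 1) × Fin n) F) :
    Matrix (Fin m ⊕ (Fin (k - 1) × Fin n)) (Fin k × Fin n) F :=
  Matrix.of fun s q =>
    Sum.elim
      (fun r => if h : (q.1 : ℕ) < k - 1 then Y11 r (⟨(q.1 : ℕ), h⟩, q.2)
        else α * A0 r q.2)
      (fun p => if h : (q.1 : ℕ) < k - 1 then R p (⟨(q.1 : ℕ), h⟩, q.2) else 0) s

/-! ### trimming -/

/-- The rows `[0 ∣ Q₂*] (M ⊗ I_m)`. -/
def bottomRows {k m n c : ℕ} (M : Matrix (Fin k) (Fin k) F)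
    (Q : Matrix (Fin (k - 1) × Fin m) ((Fin (k - 1) × Fin n) ⊕ Fin c) F) :
    Matrix (Fin c) (Fin k × Fin m) F :=
  (Matrix.of fun (j : Fin c) (p : Fin k × Fin m) =>
      if h : (p.1 : ℕ) = 0 then 0
      else star (Q (⟨(p.1 : ℕ) - 1, by have := p.1.isLt; omega⟩, p.2) (Sum.inr j)))
    * kronId M

/-- The square matrix `[D ; [0 ∣ Q₂*](M ⊗ I_m)]` whose invertibility makes `D` admissible. -/
def trimAux {k m n c : ℕ} (M : Matrix (Fin k) (Fin k) F)
    (Q : Matrix (Fin (k - 1) × Fin m) ((Fin (k - 1) × Fin n) ⊕ Fin c) F)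
    (D : Matrix (Fin m ⊕ (Fin (k - 1) × Fin n)) (Fin k × Fin m) F) :
    Matrix ((Fin m ⊕ (Fin (k - 1) × Fin n)) ⊕ Fin c) (Fin k × Fin m) F :=
  Matrix.of (Sum.elim (fun i j => D i j) (fun i j => bottomRows M Q i j))

/-- The columns `(M̂ᵀ ⊗ I_n) [0 ; Q₂]`. -/
def rightCols {k m n c : ℕ} (M : Matrix (Fin k) (Fin k) F)
    (Q : Matrix (Fin (k - 1) × Fin n) ((Fin (k - 1) × Fin m) ⊕ Fin c) F) :
    Matrix (Fin k × Fin n) (Fin c) F :=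
  kronId Mᵀ *
    (Matrix.of fun (q : Fin k × Fin n) (j : Fin c) =>
      if h : (q.1 : ℕ) = 0 then 0
      else Q (⟨(q.1 : ℕ) - 1, by have := q.1.isLt; omega⟩, q.2) (Sum.inr j))

/-- The square matrix `[D̂ ∣ (M̂ᵀ ⊗ I_n)[0 ; Q₂]]` whose invertibility makes `D̂` admissible. -/
def trimAux2 {k m n c : ℕ} (M : Matrix (Fin k) (Fin k) F)
    (Q : Matrix (Fin (k - 1) × Fin n) ((Fin (k - 1) × Fin m) ⊕ Fin c) F)
    (D : Matrix (Fin k × Fin n) (Fin n ⊕ (Fin (k - 1) × Fin m)) F) :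
    Matrix (Fin k × Fin n) ((Fin n ⊕ (Fin (k - 1) × Fin m)) ⊕ Fin c) F :=
  Matrix.of fun q s => Sum.elim (fun t => D q t) (fun j => rightCols M Q q j) s

/-! ### transfer of minimal bases between null spaces -/

section Transfer

variable {ρ ρ' γ γ' ι : Type*}

lemma polyVec_mulVec [Fintype γ] (B : Matrix γ' γ F[X]) (x : γ → F[X]) :
    polyVec (B *ᵥ x) = matRF B *ᵥ polyVec x := by
  ext i
  exact RingHom.map_mulVec (algebraMap F[X] (RatFunc F)) B x i

lemma polyVec_injective : Function.Injective (polyVec : (γ → F[X]) → γ → RatFunc F) := by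
  intro x y h
  ext1 i
  exact RatFunc.algebraMap_injective F (congrFun h i)

lemma matRF_mul [Fintype γ] (B : Matrix ρ γ F[X]) (B' : Matrix γ γ' F[X]) :
    matRF (B * B') = matRF B * matRF B' :=
  Matrix.map_mul

lemma matRF_one_add [DecidableEq γ] (B : Matrix γ γ F[X]) : matRF (1 + B) = 1 + matRF B := by
  ext i j
  by_cases h : i = j <;> simp [matRF, h]

variable [Fintype γ]

lemma mem_Nr {P : Matrix ρ γ F[X]} {x : γ → RatFunc F} : x ∈ Nr P ↔ matRF P *ᵥ x = 0 :=
  Iff.rfl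

lemma polyVec_mem_Nr {P : Matrix ρ γ F[X]} {x : γ → F[X]} :
    polyVec x ∈ Nr P ↔ P *ᵥ x = 0 := by
  have h0 : polyVec (0 : ρ → F[X]) = 0 := by
    ext i
    simp [polyVec]
  rw [mem_Nr, ← polyVec_mulVec, ← h0, polyVec_injective.eq_iff]

lemma IsPolyBasis.mem {V : Submodule (RatFunc F) (γ → RatFunc F)} {b : ι → γ → F[X]}
    (hb : IsPolyBasis V b) (i : ι) : polyVec (b i) ∈ V :=
  hb.2 ▸ Submodule.subset_span ⟨i, rfl⟩

lemma IsPolyBasis.ne_zero {V : Submodule (RatFunc F) (γ → RatFunc F)} {b : ι → γ → F[X]}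
    (hb : IsPolyBasis V b) (i : ι) : b i ≠ 0 := by
  intro h
  apply hb.1.ne_zero i
  ext j
  simp [polyVec, h]

lemma IsPolyBasis.card_eq {V : Submodule (RatFunc F) (γ → RatFunc F)} [Fintype ι]
    {b : ι → γ → F[X]} (hb : IsPolyBasis V b) :
    Fintype.card ι = Module.finrank (RatFunc F) V := by
  rw [← hb.2, finrank_span_eq_card hb.1]

lemma sum_polyVecDeg_mulVec [Fintype γ'] [Fintype ι] {P : Matrix ρ γ F[X]}
    {B : Matrix γ' γ F[X]} {c : ℕ}
    (hdeg : ∀ x : γ → F[X], x ≠ 0 → P *ᵥ x = 0 → polyVecDeg (B *ᵥ x) = polyVecDeg x + c)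
    {b : ι → γ → F[X]} (hb : IsPolyBasis (Nr P) b) :
    ∑ i, polyVecDeg (B *ᵥ b i) =
      ∑ i, polyVecDeg (b i) + Module.finrank (RatFunc F) (Nr P) * c := by
  rw [← hb.card_eq, Finset.sum_congr rfl fun i _ =>
    hdeg (b i) (hb.ne_zero i) (polyVec_mem_Nr.1 (hb.mem i)), Finset.sum_add_distrib]
  simp

variable [Fintype ρ] [Fintype ρ'] [Fintype γ'] [DecidableEq γ] [DecidableEq γ']

/-- Polynomial matrices `B` and `B'` restrict to mutually inverse isomorphisms between the
right null spaces of `P` and `P'`, as witnessed by polynomial identities. -/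
structure NullEquiv (P : Matrix ρ γ F[X]) (P' : Matrix ρ' γ' F[X])
    (B : Matrix γ' γ F[X]) (B' : Matrix γ γ' F[X]) : Prop where
  maps : ∃ S : Matrix ρ' ρ F[X], P' * B = S * P
  maps_inv : ∃ S : Matrix ρ ρ' F[X], P * B' = S * P'
  left_inv : ∃ S : Matrix γ ρ F[X], B' * B = 1 + S * P
  right_inv : ∃ S : Matrix γ' ρ' F[X], B * B' = 1 + S * P'

namespace NullEquiv

variable {P : Matrix ρ γ F[X]} {P' : Matrix ρ' γ' F[X]}
  {B : Matrix γ' γ F[X]} {B' : Matrix γ γ' F[X]}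

lemma symm (h : NullEquiv P P' B B') : NullEquiv P' P B' B :=
  ⟨h.maps_inv, h.maps, h.right_inv, h.left_inv⟩

lemma mulVec_mem (h : NullEquiv P P' B B') {x : γ → RatFunc F} (hx : x ∈ Nr P) :
    matRF B *ᵥ x ∈ Nr P' := by
  obtain ⟨S, hS⟩ := h.maps
  rw [mem_Nr] at hx ⊢
  rw [Matrix.mulVec_mulVec, ← matRF_mul, hS, matRF_mul, ← Matrix.mulVec_mulVec, hx,
    Matrix.mulVec_zero]

lemma mulVec_mulVec (h : NullEquiv P P' B B') {x : γ → RatFunc F} (hx : x ∈ Nr P) :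
    matRF B' *ᵥ (matRF B *ᵥ x) = x := by
  obtain ⟨S, hS⟩ := h.left_inv
  rw [mem_Nr] at hx
  rw [Matrix.mulVec_mulVec, ← matRF_mul, hS, matRF_one_add, matRF_mul, Matrix.add_mulVec,
    ← Matrix.mulVec_mulVec, hx, Matrix.mulVec_zero, Matrix.one_mulVec, add_zero]

lemma mulVec_mulVec_poly (h : NullEquiv P P' B B') {x : γ → F[X]} (hx : polyVec x ∈ Nr P) :
    B' *ᵥ (B *ᵥ x) = x := by
  apply polyVec_injective
  rw [polyVec_mulVec, polyVec_mulVec, h.mulVec_mulVec hx]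

lemma map_Nr (h : NullEquiv P P' B B') : (Nr P).map (matRF B).mulVecLin = Nr P' := by
  apply le_antisymm
  · rintro _ ⟨x, hx, rfl⟩
    exact h.mulVec_mem hx
  · intro y hy
    exact ⟨matRF B' *ᵥ y, h.symm.mulVec_mem hy, h.symm.mulVec_mulVec hy⟩

lemma isPolyBasis (h : NullEquiv P P' B B') {b : ι → γ → F[X]} (hb : IsPolyBasis (Nr P) b) :
    IsPolyBasis (Nr P') fun i => B *ᵥ b i := by
  have hcomp : (fun i => polyVec (B *ᵥ b i)) =
      (matRF B).mulVecLin ∘ fun i => polyVec (b i) := by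
    ext1 i
    exact polyVec_mulVec _ _
  constructor
  · rw [hcomp]
    apply hb.1.map
    rw [hb.2, Submodule.disjoint_def]
    intro x hx hx0
    rw [← h.mulVec_mulVec hx, show matRF B *ᵥ x = 0 from hx0, Matrix.mulVec_zero]
  · rw [hcomp, Set.range_comp, Submodule.span_image, hb.2, h.map_Nr]

variable [Fintype ι] {c : ℕ}

lemma isMinimalBasis (h : NullEquiv P P' B B')
    (hdeg : ∀ x : γ → F[X], x ≠ 0 → P *ᵥ x = 0 → polyVecDeg (B *ᵥ x) = polyVecDeg x + c)
    {b : ι → γ → F[X]} (hb : IsMinimalBasis (Nr P) b) :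
    IsMinimalBasis (Nr P') fun i => B *ᵥ b i := by
  refine ⟨h.isPolyBasis hb.1, fun d b' hb' => ?_⟩
  have key := sum_polyVecDeg_mulVec hdeg (h.symm.isPolyBasis hb')
  simp only [h.symm.mulVec_mulVec_poly (hb'.mem _)] at key
  rw [sum_polyVecDeg_mulVec hdeg hb.1, key]
  exact Nat.add_le_add_right (hb.2 _ _ (h.symm.isPolyBasis hb')) _

lemma isMinimalBasis_inv (h : NullEquiv P P' B B')
    (hdeg : ∀ x : γ → F[X], x ≠ 0 → P *ᵥ x = 0 → polyVecDeg (B *ᵥ x) = polyVecDeg x + c)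
    {b : ι → γ' → F[X]} (hb : IsMinimalBasis (Nr P') b) :
    IsMinimalBasis (Nr P) fun i => B' *ᵥ b i := by
  refine ⟨h.symm.isPolyBasis hb.1, fun d b' hb' => ?_⟩
  have key := sum_polyVecDeg_mulVec hdeg (h.symm.isPolyBasis hb.1)
  simp only [h.symm.mulVec_mulVec_poly (hb.1.mem _)] at key
  have := hb.2 _ _ (h.isPolyBasis hb')
  rw [sum_polyVecDeg_mulVec hdeg hb', key] at this
  exact Nat.le_of_add_le_add_right this

lemma hasMinIndices_iff (h : NullEquiv P P' B B')
    (hdeg : ∀ x : γ → F[X], x ≠ 0 → P *ᵥ x = 0 → polyVecDeg (B *ᵥ x) = polyVecDeg x + c)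
    {d : ℕ} (ε : Fin d → ℕ) :
    HasMinIndices (Nr P) ε ↔ HasMinIndices (Nr P') fun i => ε i + c := by
  constructor
  · rintro ⟨b, hb, hε⟩
    refine ⟨_, h.isMinimalBasis hdeg hb, fun i => ?_⟩
    rw [hdeg _ (hb.1.ne_zero i) (polyVec_mem_Nr.1 (hb.1.mem i)), hε]
  · rintro ⟨b, hb, hε⟩
    have hb' := h.isMinimalBasis_inv hdeg hb
    refine ⟨_, hb', fun i => ?_⟩
    have := hdeg _ (hb'.1.ne_zero i) (polyVec_mem_Nr.1 (hb'.1.mem i))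
    rw [h.symm.mulVec_mulVec_poly (hb.1.mem i), hε] at this
    exact (Nat.add_right_cancel this).symm

end NullEquiv

end Transfer

/-! ### pencils of the form `N [U ; H]` with `H` a right invertible pencil -/

section Factored

/-- `[E ; H]` and `[Λ ∣ K]` are mutually inverse block matrices. -/
structure BlockInverse {ν σ γ : Type*} [Fintype ν] [Fintype σ] [Fintype γ] [DecidableEq ν]
    [DecidableEq σ] [DecidableEq γ] (H : Matrix σ γ F[X]) (Λ : Matrix γ ν F[X])
    (K : Matrix γ σ F[X]) (E : Matrix ν γ F[X]) : Prop where
  H_mul_Λ : H * Λ = 0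
  H_mul_K : H * K = 1
  E_mul_Λ : E * Λ = 1
  E_mul_K : E * K = 0
  add_eq_one : Λ * E + K * H = 1

variable {μ ν σ γ : Type*} [Fintype μ] [Fintype ν] [Fintype σ] [Fintype γ]
  [DecidableEq μ] [DecidableEq ν] [DecidableEq σ] [DecidableEq γ]
  {H : Matrix σ γ F[X]} {Λ : Matrix γ ν F[X]} {K : Matrix γ σ F[X]} {E : Matrix ν γ F[X]}
  {U : Matrix μ γ F[X]} {P : Matrix μ ν F[X]} {N N' : Matrix (μ ⊕ σ) (μ ⊕ σ) F[X]} {a a' : F[X]}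

variable (F μ σ) in
/-- The block column `[I ; 0]`. -/
abbrev topInl : Matrix (μ ⊕ σ) μ F[X] := Matrix.fromRows 1 0

variable (F μ σ) in
/-- The block row `[0 ∣ I]`. -/
abbrev projInr : Matrix σ (μ ⊕ σ) F[X] := Matrix.fromCols 0 1

/-- The block row `[I ∣ -U K]`. -/
abbrev schurRow (U : Matrix μ γ F[X]) (K : Matrix γ σ F[X]) : Matrix μ (μ ⊕ σ) F[X] :=
  Matrix.fromCols 1 (-(U * K))

lemma BlockInverse.of_card (hcard : Fintype.card γ = Fintype.card ν + Fintype.card σ)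
    (h₁ : H * Λ = 0) (h₂ : H * K = 1) (h₃ : E * Λ = 1) (h₄ : E * K = 0) :
    BlockInverse H Λ K E := by
  refine ⟨h₁, h₂, h₃, h₄, ?_⟩
  rw [← Matrix.fromCols_mul_fromRows,
    Matrix.mul_eq_one_comm_of_card_eq _ _ _ (by simpa using hcard),
    Matrix.fromRows_mul_fromCols, h₁, h₂, h₃, h₄, Matrix.fromBlocks_one]

lemma mul_fromRows_mul_Λ (h : BlockInverse H Λ K E) (hU : U * Λ = a • P) :
    N * Matrix.fromRows U H * Λ = (a • (N * topInl F μ σ)) * P := by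
  have hsmul : Matrix.fromRows (a • P) (0 : Matrix σ ν F[X]) = a • Matrix.fromRows P 0 := by
    ext (i | i) j <;> simp
  rw [Matrix.mul_assoc, Matrix.fromRows_mul, h.H_mul_Λ, hU, Matrix.smul_mul, Matrix.mul_assoc,
    Matrix.fromRows_mul, Matrix.one_mul, Matrix.zero_mul, hsmul, Matrix.mul_smul]

lemma mul_mul_fromRows (h : BlockInverse H Λ K E) (hU : U * Λ = a • P) (haa : a' * a = 1)
    (hN : N' * N = 1) :
    (a' • (schurRow U K * N')) * (N * Matrix.fromRows U H) = P * E := by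
  have hUE : a • (P * E) = U - U * K * H := by
    rw [← Matrix.smul_mul, ← hU, Matrix.mul_assoc, eq_sub_of_add_eq h.add_eq_one,
      Matrix.mul_sub, Matrix.mul_one, Matrix.mul_assoc]
  rw [Matrix.smul_mul, Matrix.mul_assoc, ← Matrix.mul_assoc N', hN, Matrix.one_mul,
    Matrix.fromCols_mul_fromRows, Matrix.one_mul, Matrix.neg_mul, ← sub_eq_add_neg, ← hUE,
    smul_smul, haa, one_smul]

lemma smul_fromCols_mul_smul_fromRows (haa : a' * a = 1) (hN : N' * N = 1) :
    (a' • (schurRow U K * N')) * (a • (N * topInl F μ σ)) = 1 := by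
  rw [Matrix.smul_mul, Matrix.mul_smul, smul_smul, haa, one_smul, Matrix.mul_assoc,
    ← Matrix.mul_assoc N', hN, Matrix.one_mul, Matrix.fromCols_mul_fromRows]
  simp

lemma Λ_mul_E (h : BlockInverse H Λ K E) (hN : N' * N = 1) :
    Λ * E = 1 + -(K * projInr F μ σ * N') * (N * Matrix.fromRows U H) := by
  rw [Matrix.neg_mul, Matrix.mul_assoc, ← Matrix.mul_assoc N', hN, Matrix.one_mul,
    Matrix.mul_assoc, Matrix.fromCols_mul_fromRows, eq_sub_of_add_eq h.add_eq_one]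
  simp [sub_eq_add_neg]

lemma smul_fromRows_mul_smul_fromCols (h : BlockInverse H Λ K E) (haa : a' * a = 1)
    (hN : N' * N = 1) :
    (a • (N * topInl F μ σ)) * (a' • (schurRow U K * N')) =
      1 + (N * Matrix.fromRows U H) * -(K * projInr F μ σ * N') := by
  have hblk : topInl F μ σ *
      schurRow U K =
        1 - Matrix.fromRows U H * K * projInr F μ σ := by
    rw [Matrix.fromRows_mul_fromCols, Matrix.fromRows_mul, h.H_mul_K,
      Matrix.fromRows_mul_fromCols, ← Matrix.fromBlocks_one, sub_eq_add_neg, Matrix.fromBlocks_neg,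
      Matrix.fromBlocks_add]
    simp
  calc _ = N * (topInl F μ σ *
          schurRow U K) * N' := by
        rw [Matrix.smul_mul, Matrix.mul_smul, smul_smul, mul_comm, haa, one_smul]
        simp only [Matrix.mul_assoc]
    _ = _ := by
        rw [hblk, Matrix.mul_sub, Matrix.sub_mul, Matrix.mul_one, mul_eq_one_comm.1 hN]
        simp only [Matrix.mul_assoc, Matrix.mul_neg, sub_eq_add_neg]

lemma nullEquiv_right (h : BlockInverse H Λ K E) (hU : U * Λ = a • P) (haa : a' * a = 1)
    (hN : N' * N = 1) : NullEquiv P (N * Matrix.fromRows U H) Λ E where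
  maps := ⟨_, mul_fromRows_mul_Λ h hU⟩
  maps_inv := ⟨_, (mul_mul_fromRows h hU haa hN).symm⟩
  left_inv := ⟨0, by rw [h.E_mul_Λ, Matrix.zero_mul, add_zero]⟩
  right_inv := ⟨_, Λ_mul_E h hN⟩

lemma nullEquiv_left (h : BlockInverse H Λ K E) (hU : U * Λ = a • P) (haa : a' * a = 1)
    (hN : N' * N = 1) : NullEquiv (N * Matrix.fromRows U H)ᵀ Pᵀ
      (a • (N * topInl F μ σ))ᵀ (a' • (schurRow U K * N'))ᵀ where
  maps := ⟨Λᵀ, by rw [← Matrix.transpose_mul, ← Matrix.transpose_mul, mul_fromRows_mul_Λ h hU]⟩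
  maps_inv := ⟨Eᵀ, by
    rw [← Matrix.transpose_mul, ← Matrix.transpose_mul, mul_mul_fromRows h hU haa hN]⟩
  left_inv := ⟨(-(K * projInr F μ σ * N'))ᵀ, by
    rw [← Matrix.transpose_mul, ← Matrix.transpose_mul,
      smul_fromRows_mul_smul_fromCols h haa hN, Matrix.transpose_add, Matrix.transpose_one]⟩
  right_inv := ⟨0, by
    rw [← Matrix.transpose_mul, smul_fromCols_mul_smul_fromRows haa hN, Matrix.transpose_one,
      Matrix.zero_mul, add_zero]⟩

lemma isLin_of_blockInverse {m n s : ℕ} {H : Matrix σ γ F[X]} {Λ : Matrix γ (Fin n) F[X]}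
    {K : Matrix γ σ F[X]} {E : Matrix (Fin n) γ F[X]} {U : Matrix (Fin m) γ F[X]}
    {P : Matrix (Fin m) (Fin n) F[X]} {N N' : Matrix (Fin m ⊕ σ) (Fin m ⊕ σ) F[X]}
    (h : BlockInverse H Λ K E) (hcard : Fintype.card γ = n + s) (hs : Fintype.card σ = s)
    (hU : U * Λ = a • P) (haa : a' * a = 1) (hN : N' * N = 1) :
    IsLin s P (N * Matrix.fromRows U H) := by
  let eσ : σ ≃ Fin s := Fintype.equivFinOfCardEq hs
  let er : Fin m ⊕ σ ≃ Fin m ⊕ Fin s := (Equiv.refl _).sumCongr eσ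
  let en : Fin n ⊕ σ ≃ Fin n ⊕ Fin s := (Equiv.refl _).sumCongr eσ
  let ec : γ ≃ Fin n ⊕ Fin s := Fintype.equivOfCardEq (by simpa using hcard)
  let T : Matrix (Fin m ⊕ σ) (Fin m ⊕ σ) F[X] :=
    Matrix.fromBlocks (a' • 1) (-(a' • (U * K))) 0 1
  have hTN : IsUnit (T * N').det := by
    have ha : IsUnit a' := IsUnit.of_mul_eq_one a haa
    rw [Matrix.det_mul, Matrix.det_fromBlocks_zero₂₁, Matrix.det_smul, Matrix.det_one,
      Matrix.det_one, mul_one, mul_one]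
    exact (ha.pow _).mul ((Matrix.isUnit_iff_isUnit_det _).1 (IsUnit.of_mul_eq_one N hN))
  let G : Matrix γ (Fin n ⊕ σ) F[X] := Matrix.fromCols Λ K
  let G' : Matrix (Fin n ⊕ σ) γ F[X] := Matrix.fromRows E H
  have hG : G * G' = 1 := by rw [Matrix.fromCols_mul_fromRows, h.add_eq_one]
  have key : T * N' * (N * Matrix.fromRows U H) * G = Matrix.fromBlocks P 0 0 1 := by
    rw [Matrix.mul_assoc T, ← Matrix.mul_assoc N', hN, Matrix.one_mul, Matrix.mul_assoc T,
      Matrix.fromRows_mul_fromCols, hU, h.H_mul_Λ, h.H_mul_K, Matrix.fromBlocks_multiply]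
    simp [smul_smul, mul_comm a, haa]
  refine ⟨er, ec, Matrix.reindex er er (T * N'), Matrix.reindex ec en G, ?_, ?_, ?_⟩
  · rwa [Matrix.det_reindex_self]
  · rw [← Matrix.isUnit_iff_isUnit_det]
    refine IsUnit.of_mul_eq_one (Matrix.reindex en ec G') ?_
    simp only [Matrix.reindex_apply, Matrix.submatrix_mul_equiv, hG, Matrix.submatrix_one_equiv]
  · simp only [Matrix.reindex_apply, Matrix.submatrix_mul_equiv, key]
    ext i j
    rcases i with i | i <;> rcases j with j | j <;> simp [er, en, Matrix.one_apply]

end Factored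

/-! ### the pencil `H_{k-1}(λ) ⊗ I_n` and its reversal -/

section Shift

lemma pencil_eq {ρ γ : Type*} (X₁ Y₁ : Matrix ρ γ F) :
    pencil X₁ Y₁ = (Polynomial.X : F[X]) • X₁.map C + Y₁.map C := by
  ext1 i j
  simp [pencil]

variable {k n : ℕ}

lemma sum_block_ite {R : Type*} [AddCommMonoid R] (f : Fin k × Fin n → R) (i : Fin k) (c : Fin n)
    (φ : Fin k → Prop) [DecidablePred φ] (hφ : ∀ j, φ j ↔ j = i) :
    ∑ q : Fin k × Fin n, (if c = q.2 ∧ φ q.1 then f q else 0) = f (i, c) := by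
  rw [Finset.sum_eq_single (i, c)]
  · simp [hφ]
  · rintro ⟨j, d⟩ - hne
    rw [if_neg]
    rintro ⟨rfl, hj⟩
    exact hne (by rw [(hφ j).1 hj])
  · simp

lemma pencil_Hlam_Hconst_mul {γ : Type*} (K : Matrix (Fin k × Fin n) γ F[X])
    (s : Fin (k - 1) × Fin n) (c : γ) :
    (pencil (Hlam F k n) (Hconst F k n) * K) s c =
      X * K (⟨s.1 + 1, by omega⟩, s.2) c - K (⟨s.1, by omega⟩, s.2) c := by
  rw [← sum_block_ite (fun q => K q c) ⟨s.1 + 1, by omega⟩ s.2 (fun j => (j : ℕ) = s.1 + 1)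
      (fun j => by simp [Fin.ext_iff]),
    ← sum_block_ite (fun q => K q c) ⟨s.1, by omega⟩ s.2 (fun j => (j : ℕ) = s.1)
      (fun j => by simp [Fin.ext_iff]), Finset.mul_sum, ← Finset.sum_sub_distrib,
    Matrix.mul_apply]
  refine Finset.sum_congr rfl fun q _ => ?_
  simp only [pencil, Hlam, Hconst, Matrix.of_apply]
  split_ifs <;> simp <;> ring

lemma pencil_Hconst_Hlam_mul {γ : Type*} (K : Matrix (Fin k × Fin n) γ F[X])
    (s : Fin (k - 1) × Fin n) (c : γ) :
    (pencil (Hconst F k n) (Hlam F k n) * K) s c =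
      K (⟨s.1 + 1, by omega⟩, s.2) c - X * K (⟨s.1, by omega⟩, s.2) c := by
  rw [← sum_block_ite (fun q => K q c) ⟨s.1 + 1, by omega⟩ s.2 (fun j => (j : ℕ) = s.1 + 1)
      (fun j => by simp [Fin.ext_iff]),
    ← sum_block_ite (fun q => K q c) ⟨s.1, by omega⟩ s.2 (fun j => (j : ℕ) = s.1)
      (fun j => by simp [Fin.ext_iff]), Finset.mul_sum, ← Finset.sum_sub_distrib,
    Matrix.mul_apply]
  refine Finset.sum_congr rfl fun q _ => ?_
  simp only [pencil, Hlam, Hconst, Matrix.of_apply]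
  split_ifs <;> simp <;> ring

variable (F k n) in
/-- The row selecting the `i`-th block of a vector in `F(λ)^{kn}`. -/
def blockRow (i : Fin k) : Matrix (Fin n) (Fin k × Fin n) F[X] :=
  Matrix.of fun r q => if r = q.2 ∧ q.1 = i then 1 else 0

lemma blockRow_mul {γ : Type*} (i : Fin k) (K : Matrix (Fin k × Fin n) γ F[X]) (r : Fin n)
    (c : γ) : (blockRow F k n i * K) r c = K (i, r) c := by
  rw [← sum_block_ite (fun q => K q c) i r (fun j => j = i) (fun j => Iff.rfl), Matrix.mul_apply]
  refine Finset.sum_congr rfl fun q _ => ?_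
  simp only [blockRow, Matrix.of_apply, ite_mul, one_mul, zero_mul]

variable (F k n) in
/-- A right inverse of `H_{k-1}(λ) ⊗ I_n`. -/
def shiftInv : Matrix (Fin k × Fin n) (Fin (k - 1) × Fin n) F[X] :=
  Matrix.of fun p s => if p.2 = s.2 ∧ (p.1 : ℕ) ≤ s.1 then -X ^ ((s.1 : ℕ) - p.1) else 0

variable (F k n) in
/-- A right inverse of the reversal of `H_{k-1}(λ) ⊗ I_n`. -/
def shiftInvRev : Matrix (Fin k × Fin n) (Fin (k - 1) × Fin n) F[X] :=
  Matrix.of fun p s => if p.2 = s.2 ∧ (s.1 : ℕ) < p.1 then X ^ ((p.1 : ℕ) - 1 - s.1) else 0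

variable (F k n) in
/-- `rev Λ_k(λ) ⊗ I_n`. -/
def LamRev : Matrix (Fin k × Fin n) (Fin n) F[X] :=
  Matrix.of fun p c => if p.2 = c then X ^ (p.1 : ℕ) else 0

lemma card_block (hk : 0 < k) : Fintype.card (Fin k × Fin n) = n + (k - 1) * n := by
  obtain ⟨t, rfl⟩ : ∃ t, k = t + 1 := ⟨k - 1, by omega⟩
  simp
  ring

lemma blockInverse_shift (hk : 0 < k) :
    BlockInverse (pencil (Hlam F k n) (Hconst F k n)) (Lam F k n) (shiftInv F k n)
      (blockRow F k n ⟨k - 1, by omega⟩) := by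
  apply BlockInverse.of_card
  · simpa using card_block (n := n) hk
  · ext1 s c
    rw [pencil_Hlam_Hconst_mul]
    simp only [Lam, Matrix.of_apply, Matrix.zero_apply]
    split_ifs
    · rw [← pow_succ', sub_eq_zero]
      congr 1
      omega
    · simp
  · ext1 ⟨s, d⟩ ⟨t, c⟩
    rw [pencil_Hlam_Hconst_mul]
    simp only [shiftInv, Matrix.of_apply, Matrix.one_apply, Prod.mk.injEq, Fin.ext_iff]
    by_cases hd : (d : ℕ) = c
    · rcases lt_trichotomy (s : ℕ) t with h | h | h
      · rw [if_pos ⟨hd, h⟩, if_pos ⟨hd, h.le⟩, if_neg (by omega), mul_neg, ← pow_succ',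
          show (t : ℕ) - (s + 1) + 1 = t - s by omega]
        ring
      · simp [hd, h]
      · rw [if_neg (by omega), if_neg (by omega), if_neg (by omega)]
        simp
    · simp [hd]
  · ext1 r c
    rw [blockRow_mul]
    simp [Lam, Matrix.one_apply]
  · ext1 r ⟨s, c⟩
    rw [blockRow_mul]
    simp only [shiftInv, Matrix.of_apply, Matrix.zero_apply]
    rw [if_neg (by omega)]

lemma blockInverse_shiftRev (hk : 0 < k) :
    BlockInverse (pencil (Hconst F k n) (Hlam F k n)) (LamRev F k n) (shiftInvRev F k n)
      (blockRow F k n ⟨0, hk⟩) := by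
  apply BlockInverse.of_card
  · simpa using card_block (n := n) hk
  · ext1 s c
    rw [pencil_Hconst_Hlam_mul]
    simp only [LamRev, Matrix.of_apply, Matrix.zero_apply]
    split_ifs
    · ring
    · simp
  · ext1 ⟨s, d⟩ ⟨t, c⟩
    rw [pencil_Hconst_Hlam_mul]
    simp only [shiftInvRev, Matrix.of_apply, Matrix.one_apply, Prod.mk.injEq, Fin.ext_iff]
    by_cases hd : (d : ℕ) = c
    · rcases lt_trichotomy (s : ℕ) t with h | h | h
      · rw [if_neg (by omega), if_neg (by omega), if_neg (by omega)]
        simp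
      · simp [hd, h]
      · rw [if_pos ⟨hd, by omega⟩, if_pos ⟨hd, h⟩, if_neg (by omega), ← pow_succ',
          show (s : ℕ) - 1 - t + 1 = s + 1 - 1 - t by omega, sub_self]
    · simp [hd]
  · ext1 r c
    rw [blockRow_mul]
    simp [LamRev, Matrix.one_apply]
  · ext1 r ⟨s, c⟩
    rw [blockRow_mul]
    simp [shiftInvRev]

/-! ### reversals -/

lemma revMat_pencil {ρ γ : Type*} (X₁ Y₁ : Matrix ρ γ F) :
    revMat 1 (pencil X₁ Y₁) = pencil Y₁ X₁ := by
  ext1 i j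
  have h := reflect_C_mul_X_pow 1 1 (c := X₁ i j)
  rw [pow_one, revAt_le le_rfl] at h
  simp only [revMat, pencil, Matrix.map_apply, Matrix.of_apply, reflect_add, reflect_C, h]
  simp [add_comm]

lemma revMat_Lam : revMat (k - 1) (Lam F k n) = LamRev F k n := by
  ext1 p c
  simp only [revMat, Lam, LamRev, Matrix.map_apply, Matrix.of_apply]
  split_ifs
  · rw [reflect_monomial, revAt_le (Nat.sub_le _ _)]
    congr 1
    omega
  · exact reflect_zero

lemma revMat_mul {ρ γ τ : Type*} [Fintype γ] {A : Matrix ρ γ F[X]} {B : Matrix γ τ F[X]}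
    {a b : ℕ} (hA : ∀ i j, (A i j).natDegree ≤ a) (hB : ∀ i j, (B i j).natDegree ≤ b) :
    revMat (a + b) (A * B) = revMat a A * revMat b B := by
  ext1 i j
  let φ : F[X] →+ F[X] := ⟨⟨reflect (a + b), reflect_zero⟩, fun f g => reflect_add f g _⟩
  simp only [revMat, Matrix.map_apply, Matrix.mul_apply]
  refine (map_sum φ _ _).trans (Finset.sum_congr rfl fun q _ => ?_)
  exact reflect_mul _ _ (hA i q) (hB q j)

lemma natDegree_pencil_le {ρ γ : Type*} (X₁ Y₁ : Matrix ρ γ F) (i : ρ) (j : γ) :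
    (pencil X₁ Y₁ i j).natDegree ≤ 1 :=
  natDegree_linear_le

lemma pencil_mul_LamRev {m : ℕ} (hk : 0 < k) {X₁ Y₁ : Matrix (Fin m) (Fin k × Fin n) F} {α : F}
    {P : Matrix (Fin m) (Fin n) F[X]} (h : pencil X₁ Y₁ * Lam F k n = C α • P) :
    pencil Y₁ X₁ * LamRev F k n = C α • revMat k P := by
  have hLam : ∀ p c, (Lam F k n p c).natDegree ≤ k - 1 := by
    intro p c
    simp only [Lam, Matrix.of_apply]
    split_ifs
    · rw [natDegree_X_pow]
      exact Nat.sub_le _ _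
    · simp
  rw [← revMat_pencil, ← revMat_Lam, ← revMat_mul (natDegree_pencil_le _ _) hLam, h,
    show 1 + (k - 1) = k by omega]
  ext1 i j
  simp [revMat, reflect_C_mul]

end Shift

/-! ### the factorization of the trimmed pencil -/

section Trim

variable {k m n : ℕ}

lemma kronId_mul_kronId (M₁ M₂ : Matrix (Fin k) (Fin k) F) :
    (kronId M₁ * kronId M₂ : Matrix (Fin k × Fin m) (Fin k × Fin m) F) = kronId (M₁ * M₂) := by
  have h : ∀ M : Matrix (Fin k) (Fin k) F,
      (kronId M : Matrix (Fin k × Fin m) (Fin k × Fin m) F) = Matrix.kronecker M 1 := by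
    intro M
    ext p q
    simp [kronId, Matrix.one_apply]
  have h' := Matrix.mul_kronecker_mul M₁ M₂ (1 : Matrix (Fin m) (Fin m) F)
    (1 : Matrix (Fin m) (Fin m) F)
  rw [h, h, h]
  rw [Matrix.one_mul] at h'
  exact h'.symm

lemma kronId_one : (kronId 1 : Matrix (Fin k × Fin m) (Fin k × Fin m) F) = 1 := by
  ext p q
  simp only [kronId, Matrix.of_apply, Matrix.one_apply, Prod.ext_iff]
  split_ifs <;> simp_all

lemma map_mul_pencil {ρ ρ' γ : Type*} [Fintype ρ] (S : Matrix ρ' ρ F) (X₁ Y₁ : Matrix ρ γ F) :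
    S.map C * pencil X₁ Y₁ = pencil (S * X₁) (S * Y₁) := by
  rw [pencil_eq, pencil_eq, Matrix.map_mul, Matrix.map_mul, Matrix.mul_add, Matrix.mul_smul]

lemma kronId_mul_vkron (M : Matrix (Fin k) (Fin k) F) (v : Fin k → F)
    (P : Matrix (Fin m) (Fin n) F[X]) :
    (kronId (m := m) M).map C * vkron v P = vkron (M *ᵥ v) P := by
  ext1 p c
  simp only [Matrix.mul_apply, Fintype.sum_prod_type, Matrix.map_apply, kronId, vkron,
    Matrix.of_apply, Matrix.mulVec, dotProduct, map_sum, Finset.sum_mul]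
  refine Finset.sum_congr rfl fun i _ => ?_
  rw [Finset.sum_eq_single p.2]
  · simp [mul_assoc]
  · intro j _ hj
    simp [hj.symm]
  · simp

lemma pencil_mul_Lam (X₁ Y₁ : Matrix (Fin k × Fin m) (Fin k × Fin n) F) (p : Fin k × Fin m)
    (c : Fin n) : (pencil X₁ Y₁ * Lam F k n) p c =
      ∑ j : Fin k, (C (X₁ p (j, c)) * X + C (Y₁ p (j, c))) * X ^ (k - 1 - (j : ℕ)) := by
  simp only [Matrix.mul_apply, Fintype.sum_prod_type, pencil, Lam, Matrix.of_apply]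
  refine Finset.sum_congr rfl fun i _ => ?_
  rw [Finset.sum_eq_single c]
  · simp
  · intro j _ hj
    simp [hj]
  · simp

lemma coeff_sum_linear_mul_X_pow (x y : Fin k → F) (e : ℕ) :
    (∑ j : Fin k, (C (x j) * X + C (y j)) * X ^ (k - 1 - (j : ℕ))).coeff e =
      ∑ j : Fin k, ((if e = k - j then x j else 0) + if e = k - 1 - j then y j else 0) := by
  rw [finsetSum_coeff]
  refine Finset.sum_congr rfl fun j _ => ?_
  rw [add_mul, mul_assoc, ← pow_succ', show k - 1 - (j : ℕ) + 1 = k - j by omega, coeff_add,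
    coeff_C_mul_X_pow, coeff_C_mul_X_pow]

/-- Coefficients of a vanishing combination `∑ (λ x_j + y_j) λ^{k-1-j}`. -/
lemma coeff_eq_of_sum_eq_zero {x y : Fin k → F}
    (h : ∑ j : Fin k, (C (x j) * X + C (y j)) * X ^ (k - 1 - (j : ℕ)) = (0 : F[X])) :
    (∀ j : Fin k, (j : ℕ) = 0 → x j = 0) ∧ (∀ j : Fin k, (j : ℕ) = k - 1 → y j = 0) ∧
      ∀ i j : Fin k, (i : ℕ) + 1 = j → x j + y i = 0 := by
  have hc : ∀ e, ∑ j : Fin k, ((if e = k - j then x j else 0) +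
      if e = k - 1 - j then y j else 0) = 0 := fun e => by
    rw [← coeff_sum_linear_mul_X_pow, h, coeff_zero]
  refine ⟨fun j hj => ?_, fun j hj => ?_, fun i j hij => ?_⟩
  · rw [← hc k, Finset.sum_eq_single j]
    · rw [if_pos (by omega), if_neg (by omega), add_zero]
    · intro i _ hi
      have := Fin.val_ne_of_ne hi
      rw [if_neg (by omega), if_neg (by omega), add_zero]
    · simp
  · rw [← hc 0, Finset.sum_eq_single j]
    · rw [if_neg (by omega), if_pos (by omega), zero_add]
    · intro i _ hi
      have := Fin.val_ne_of_ne hi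
      rw [if_neg (by omega), if_neg (by omega), add_zero]
    · simp
  · rw [← hc (k - j), Finset.sum_add_distrib, Finset.sum_eq_single j, Finset.sum_eq_single i]
    · rw [if_pos rfl, if_pos (by omega)]
    · intro l _ hl
      have := Fin.val_ne_of_ne hl
      rw [if_neg (by omega)]
    · simp
    · intro l _ hl
      have := Fin.val_ne_of_ne hl
      rw [if_neg (by omega)]
    · simp

lemma sum_block_succ {R : Type*} [AddCommMonoid R] (hk : 0 < k) (f : Fin k × Fin m → R)
    (h0 : ∀ r, f (⟨0, hk⟩, r) = 0) :
    ∑ p, f p = ∑ s : Fin (k - 1) × Fin m, f (⟨s.1 + 1, by omega⟩, s.2) := by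
  obtain ⟨t, rfl⟩ : ∃ t, k = t + 1 := ⟨k - 1, by omega⟩
  have hz : ∑ r : Fin m, f ((0 : Fin (t + 1)), r) = 0 := Finset.sum_eq_zero fun r _ => h0 r
  rw [Fintype.sum_prod_type, Fin.sum_univ_succ, hz, zero_add]
  exact (Fintype.sum_prod_type fun s : Fin t × Fin m => f (s.1.succ, s.2)).symm

/-- The block matrix `diag(I_m, -Z)`, with row index set `Fin k × Fin m`. -/
def embedZ (k : ℕ) (Z : Matrix (Fin (k - 1) × Fin m) (Fin (k - 1) × Fin n) F) :
    Matrix (Fin k × Fin m) (Fin m ⊕ (Fin (k - 1) × Fin n)) F :=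
  Matrix.fromCols (Matrix.of fun p r => if r = p.2 ∧ (p.1 : ℕ) = 0 then 1 else 0)
    (Matrix.of fun p s =>
      if h : (p.1 : ℕ) = 0 then 0 else -Z (⟨(p.1 : ℕ) - 1, by omega⟩, p.2) s)

lemma embedZ_mul_fromRows_zero {Z : Matrix (Fin (k - 1) × Fin m) (Fin (k - 1) × Fin n) F}
    {γ : Type*} (U : Matrix (Fin m) γ F) (H : Matrix (Fin (k - 1) × Fin n) γ F)
    (p : Fin k × Fin m) (hp : (p.1 : ℕ) = 0) (q : γ) :
    (embedZ k Z * Matrix.fromRows U H) p q = U p.2 q := by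
  simp [embedZ, Matrix.mul_apply, hp]

lemma embedZ_mul_fromRows_succ {Z : Matrix (Fin (k - 1) × Fin m) (Fin (k - 1) × Fin n) F}
    {γ : Type*} (U : Matrix (Fin m) γ F) (H : Matrix (Fin (k - 1) × Fin n) γ F)
    (p : Fin k × Fin m) (hp : (p.1 : ℕ) ≠ 0) (q : γ) :
    (embedZ k Z * Matrix.fromRows U H) p q = -(Z * H) (⟨(p.1 : ℕ) - 1, by omega⟩, p.2) q := by
  simp [embedZ, Matrix.mul_apply, hp]

lemma mul_Hlam {ρ : Type*} (Z : Matrix ρ (Fin (k - 1) × Fin n) F) (p : ρ) (q : Fin k × Fin n) :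
    (Z * Hlam F k n) p q =
      if h : (q.1 : ℕ) = 0 then 0 else Z p (⟨(q.1 : ℕ) - 1, by omega⟩, q.2) := by
  simp only [Matrix.mul_apply, Hlam, Matrix.of_apply, mul_ite, mul_one, mul_zero]
  split_ifs with h
  · exact Finset.sum_eq_zero fun s _ => if_neg (by omega)
  · rw [← sum_block_ite (fun s => Z p s) ⟨(q.1 : ℕ) - 1, by omega⟩ q.2
      (fun j => (q.1 : ℕ) = j + 1) (fun j => by rw [Fin.ext_iff]; simp only; omega)]
    exact Finset.sum_congr rfl fun s _ => by simp only [eq_comm (a := q.2)]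

lemma mul_Hconst {ρ : Type*} (Z : Matrix ρ (Fin (k - 1) × Fin n) F) (p : ρ)
    (q : Fin k × Fin n) :
    (Z * Hconst F k n) p q =
      if h : (q.1 : ℕ) < k - 1 then -Z p (⟨q.1, h⟩, q.2) else 0 := by
  simp only [Matrix.mul_apply, Hconst, Matrix.of_apply, mul_ite, mul_neg, mul_one, mul_zero]
  split_ifs with h
  · rw [← sum_block_ite (fun s => -Z p s) ⟨q.1, h⟩ q.2
      (fun j => (q.1 : ℕ) = j) (fun j => by rw [Fin.ext_iff]; simp only; omega)]
    exact Finset.sum_congr rfl fun s _ => by simp only [eq_comm (a := q.2)]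
  · exact Finset.sum_eq_zero fun s _ => if_neg (by omega)

/-- Block structure of a pencil in `𝕃₁(P)` whose ansatz vector is `α e₁`. -/
lemma embedZ_factorization (hk : 0 < k) {P : Matrix (Fin m) (Fin n) F[X]} {α : F}
    {X₁ Y₁ : Matrix (Fin k × Fin m) (Fin k × Fin n) F}
    (h : pencil X₁ Y₁ * Lam F k n = vkron (e1 α) P)
    (Z : Matrix (Fin (k - 1) × Fin m) (Fin (k - 1) × Fin n) F)
    (hZ : ∀ p q, Z p q = Y₁ (⟨p.1 + 1, by omega⟩, p.2) (⟨q.1, by omega⟩, q.2)) :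
    X₁ = embedZ k Z * Matrix.fromRows (Matrix.of fun r => X₁ (⟨0, hk⟩, r)) (Hlam F k n) ∧
    Y₁ = embedZ k Z * Matrix.fromRows (Matrix.of fun r => Y₁ (⟨0, hk⟩, r)) (Hconst F k n) := by
  have hrow : ∀ p : Fin k × Fin m, (p.1 : ℕ) ≠ 0 → ∀ c,
      (∀ j : Fin k, (j : ℕ) = 0 → X₁ p (j, c) = 0) ∧
      (∀ j : Fin k, (j : ℕ) = k - 1 → Y₁ p (j, c) = 0) ∧
      ∀ i j : Fin k, (i : ℕ) + 1 = j → X₁ p (j, c) + Y₁ p (i, c) = 0 := by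
    intro p hp c
    apply coeff_eq_of_sum_eq_zero
    rw [← pencil_mul_Lam, h]
    simp [vkron, e1, hp]
  have hZ' : ∀ p : Fin k × Fin m, ∀ hp : (p.1 : ℕ) ≠ 0, ∀ q,
      Z (⟨(p.1 : ℕ) - 1, by omega⟩, p.2) q = Y₁ p (⟨q.1, by omega⟩, q.2) := by
    intro p hp q
    rw [hZ]
    congr 1
    refine Prod.ext (Fin.ext ?_) rfl
    simp only
    omega
  constructor
  · ext p q
    by_cases hp : (p.1 : ℕ) = 0
    · rw [embedZ_mul_fromRows_zero _ _ p hp, Matrix.of_apply, ← show p.1 = ⟨0, hk⟩ from Fin.ext hp]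
    · rw [embedZ_mul_fromRows_succ _ _ p hp, mul_Hlam]
      split_ifs with hq
      · rw [neg_zero]
        exact (hrow p hp q.2).1 q.1 hq
      · rw [hZ' p hp]
        refine eq_neg_of_add_eq_zero_left ((hrow p hp q.2).2.2 _ q.1 ?_)
        simp only
        omega
  · ext p q
    by_cases hp : (p.1 : ℕ) = 0
    · rw [embedZ_mul_fromRows_zero _ _ p hp, Matrix.of_apply, ← show p.1 = ⟨0, hk⟩ from Fin.ext hp]
    · rw [embedZ_mul_fromRows_succ _ _ p hp, mul_Hconst]
      split_ifs with hq
      · rw [hZ' p hp, neg_neg]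
      · rw [neg_zero]
        exact (hrow p hp q.2).2.1 q.1 (by omega)

variable {c : ℕ} {Q : Matrix (Fin (k - 1) × Fin m) ((Fin (k - 1) × Fin n) ⊕ Fin c) F}
  {R : Matrix (Fin (k - 1) × Fin n) (Fin (k - 1) × Fin n) F}
  {Z : Matrix (Fin (k - 1) × Fin m) (Fin (k - 1) × Fin n) F}

lemma embedZ_mulVec_injective (hk : 0 < k) (hQ : Qᴴ * Q = 1) (hR : IsUnit R)
    (hZ : Z = Q * Matrix.fromRows R (0 : Matrix (Fin c) (Fin (k - 1) × Fin n) F)) :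
    ∀ w, embedZ k Z *ᵥ w = 0 → w = 0 := by
  intro w hw
  have hw₁ : ∀ r, w (Sum.inl r) = 0 := by
    intro r
    have := congrFun hw (⟨0, hk⟩, r)
    simpa [embedZ, Matrix.mulVec, dotProduct] using this
  have hw₂ : Z *ᵥ (fun s => w (Sum.inr s)) = 0 := by
    ext p
    have := congrFun hw (⟨p.1 + 1, by omega⟩, p.2)
    simpa [embedZ, Matrix.mulVec, dotProduct] using this
  have hRw : R *ᵥ (fun s => w (Sum.inr s)) = 0 := by
    have h : (Qᴴ * Z) *ᵥ (fun s => w (Sum.inr s)) = 0 := by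
      rw [← Matrix.mulVec_mulVec, hw₂, Matrix.mulVec_zero]
    rw [hZ, ← Matrix.mul_assoc, hQ, Matrix.one_mul] at h
    ext s
    exact congrFun h (Sum.inl s)
  have hw₂' := Matrix.mulVec_injective_iff_isUnit.2 hR (hRw.trans (Matrix.mulVec_zero R).symm)
  ext (r | s)
  · exact hw₁ r
  · exact congrFun hw₂' s

lemma bottomRows_mul_embedZ (hk : 0 < k) {M M' : Matrix (Fin k) (Fin k) F} (hM : M * M' = 1)
    (hQ : Qᴴ * Q = 1)
    (hZ : Z = Q * Matrix.fromRows R (0 : Matrix (Fin c) (Fin (k - 1) × Fin n) F)) :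
    bottomRows M Q * (kronId (m := m) M' * embedZ k Z) = 0 := by
  have hdef : bottomRows M Q = (Matrix.of fun (j : Fin c) (p : Fin k × Fin m) =>
      if h : (p.1 : ℕ) = 0 then 0
      else star (Q (⟨(p.1 : ℕ) - 1, by omega⟩, p.2) (Sum.inr j))) * kronId (m := m) M := rfl
  rw [hdef, Matrix.mul_assoc, ← Matrix.mul_assoc (kronId (m := m) M), kronId_mul_kronId, hM,
    kronId_one, Matrix.one_mul]
  have hQZ : ∀ j s, (Qᴴ * Z) (Sum.inr j) s = 0 := by
    intro j s
    rw [hZ, ← Matrix.mul_assoc, hQ, Matrix.one_mul]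
    rfl
  ext j (r | s)
  · simp only [Matrix.mul_apply, Matrix.zero_apply]
    refine Finset.sum_eq_zero fun p _ => ?_
    by_cases hp : (p.1 : ℕ) = 0 <;> simp [embedZ, hp]
  · rw [Matrix.mul_apply, sum_block_succ hk _ (by simp)]
    simpa [embedZ, Matrix.mul_apply] using hQZ j s

/-- The trimmed pencil equals `N [U ; H]` with `N` a nonsingular constant matrix,
`H = H_{k-1}(λ) ⊗ I_n` and `U(λ) (Λ_k(λ) ⊗ I_n) = α P(λ)`. -/
lemma exists_trim_factorization (hk : 0 < k) {P : Matrix (Fin m) (Fin n) F[X]}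
    {Xc Yc : Matrix (Fin k × Fin m) (Fin k × Fin n) F} {v : Fin k → F}
    (hL : RightAnsatz P (pencil Xc Yc) v) {M : Matrix (Fin k) (Fin k) F} (hM : IsUnit M)
    {α : F} (hMv : M *ᵥ v = e1 α) (hQ : Qᴴ * Q = 1) (hR : IsUnit R)
    (hQR : Zmat1 M Yc = Q * Matrix.fromRows R (0 : Matrix (Fin c) (Fin (k - 1) × Fin n) F))
    {D : Matrix (Fin m ⊕ (Fin (k - 1) × Fin n)) (Fin k × Fin m) F}
    {B : Matrix (Fin k × Fin m) ((Fin m ⊕ (Fin (k - 1) × Fin n)) ⊕ Fin c) F}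
    (hB : B * trimAux M Q D = 1) :
    ∃ (N N' : Matrix (Fin m ⊕ (Fin (k - 1) × Fin n)) (Fin m ⊕ (Fin (k - 1) × Fin n)) F)
      (U₁ U₀ : Matrix (Fin m) (Fin k × Fin n) F), N' * N = 1 ∧
      D * Xc = N * Matrix.fromRows U₁ (Hlam F k n) ∧
      D * Yc = N * Matrix.fromRows U₀ (Hconst F k n) ∧
      pencil U₁ U₀ * Lam F k n = C α • P ∧
      ∀ s r, ∑ i, D s (i, r) * v i = α * N s (Sum.inl r) := by
  obtain ⟨M', hMM', hM'M⟩ := isUnit_iff_exists.1 hM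
  have hS : kronId (m := m) M' * kronId (m := m) M = 1 := by
    rw [kronId_mul_kronId, hM'M, kronId_one]
  have hL' : pencil (kronId (m := m) M * Xc) (kronId (m := m) M * Yc) * Lam F k n =
      vkron (e1 α) P := by
    rw [← map_mul_pencil, Matrix.mul_assoc, show pencil Xc Yc * Lam F k n = vkron v P from hL,
      kronId_mul_vkron, hMv]
  obtain ⟨hX, hY⟩ := embedZ_factorization hk hL' (Zmat1 M Yc) fun _ _ => rfl
  set U₁ : Matrix (Fin m) (Fin k × Fin n) F :=
    Matrix.of fun r => (kronId (m := m) M * Xc) (⟨0, hk⟩, r)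
  set U₀ : Matrix (Fin m) (Fin k × Fin n) F :=
    Matrix.of fun r => (kronId (m := m) M * Yc) (⟨0, hk⟩, r)
  let J := kronId (m := m) M' * embedZ k (Zmat1 M Yc)
  have hN : IsUnit (D * J) := by
    rw [← Matrix.mulVec_injective_iff_isUnit]
    refine (injective_iff_map_eq_zero (D * J).mulVecLin).2 fun w hw => ?_
    replace hw : (D * J) *ᵥ w = 0 := hw
    apply embedZ_mulVec_injective hk hQ hR hQR
    have hT : trimAux M Q D *ᵥ (J *ᵥ w) = 0 := by
      ext (i | j)
      · rw [← Matrix.mulVec_mulVec] at hw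
        exact congrFun hw i
      · have h0 : bottomRows M Q *ᵥ (J *ᵥ w) = 0 := by
          rw [Matrix.mulVec_mulVec, bottomRows_mul_embedZ hk hMM' hQ hQR, Matrix.zero_mulVec]
        exact congrFun h0 j
    have hJ : J *ᵥ w = 0 := by
      rw [← Matrix.one_mulVec (J *ᵥ w), ← hB, ← Matrix.mulVec_mulVec, hT, Matrix.mulVec_zero]
    have := congrArg (fun u => kronId (m := m) M *ᵥ u) hJ
    simpa only [J, Matrix.mulVec_mulVec, ← Matrix.mul_assoc, kronId_mul_kronId, hMM', kronId_one,
      Matrix.one_mul, Matrix.mulVec_zero] using this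
  obtain ⟨N', -, hN'⟩ := isUnit_iff_exists.1 hN
  refine ⟨D * J, N', U₁, U₀, hN', ?_, ?_, ?_, ?_⟩
  · simp only [J, Matrix.mul_assoc]
    rw [← hX, ← Matrix.mul_assoc (kronId (m := m) M'), hS, Matrix.one_mul]
  · simp only [J, Matrix.mul_assoc]
    rw [← hY, ← Matrix.mul_assoc (kronId (m := m) M'), hS, Matrix.one_mul]
  · ext1 r q
    have := congrFun (congrFun hL' (⟨0, hk⟩, r)) q
    simp only [vkron, e1, Matrix.of_apply, if_true] at this
    exact this
  · intro s r
    -- `V = v ⊗ I_m` satisfies `(M ⊗ I_m) V = α diag(I_m, -Z) [I_m ; 0]`.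
    let V : Matrix (Fin k × Fin m) (Fin m) F := Matrix.of fun p c => if p.2 = c then v p.1 else 0
    let I₀ : Matrix (Fin m ⊕ (Fin (k - 1) × Fin n)) (Fin m) F := Matrix.fromRows 1 0
    have hV : kronId (m := m) M * V = α • (embedZ k (Zmat1 M Yc) * I₀) := by
      ext p c
      have h1 : (kronId (m := m) M * V) p c = if p.2 = c then (M *ᵥ v) p.1 else 0 := by
        simp only [Matrix.mul_apply, Fintype.sum_prod_type, kronId, V, Matrix.of_apply,
          Matrix.mulVec, dotProduct]
        split_ifs with h
        · refine Finset.sum_congr rfl fun i _ => ?_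
          rw [Finset.sum_eq_single c]
          · simp [h]
          · intro j _ hj
            simp [hj]
          · simp
        · refine Finset.sum_eq_zero fun i _ => Finset.sum_eq_zero fun j _ => ?_
          by_cases hj : j = c
          · simp [hj, h]
          · simp [hj]
      rw [h1, hMv, Matrix.smul_apply]
      by_cases hp : (p.1 : ℕ) = 0
      · rw [embedZ_mul_fromRows_zero _ _ p hp]
        simp [e1, hp, Matrix.one_apply]
      · rw [embedZ_mul_fromRows_succ _ _ p hp]
        simp [e1, hp]
    have hDV : D * V = α • (D * J * I₀) := by
      rw [← Matrix.one_mul V, ← hS, Matrix.mul_assoc, hV, Matrix.mul_smul, Matrix.mul_smul]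
      simp only [J, Matrix.mul_assoc]
    have h := congrFun (congrFun hDV s) r
    simpa [V, I₀, Matrix.mul_apply (M := D) (N := V), Fintype.sum_prod_type,
      Matrix.mul_apply (M := D * J), Matrix.one_apply] using h

end Trim

/-! ### degrees of null vectors -/

section Degree

variable {k m n : ℕ} {γ γ' : Type*} [Fintype γ] [Fintype γ']

lemma natDegree_le_polyVecDeg (x : γ → F[X]) (i : γ) : (x i).natDegree ≤ polyVecDeg x :=
  Finset.le_sup (f := fun i => (x i).natDegree) (Finset.mem_univ i)

lemma polyVecDeg_le {x : γ → F[X]} {d : ℕ} (h : ∀ i, (x i).natDegree ≤ d) : polyVecDeg x ≤ d :=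
  Finset.sup_le fun i _ => h i

lemma exists_natDegree_eq_polyVecDeg {x : γ → F[X]} (hx : x ≠ 0) :
    ∃ i, x i ≠ 0 ∧ (x i).natDegree = polyVecDeg x := by
  obtain ⟨j, hj⟩ := Function.ne_iff.1 hx
  obtain ⟨i, -, hi⟩ := Finset.exists_mem_eq_sup Finset.univ ⟨j, Finset.mem_univ j⟩
    fun i => (x i).natDegree
  replace hi : polyVecDeg x = (x i).natDegree := hi
  by_cases h : x i = 0
  · refine ⟨j, hj, le_antisymm (natDegree_le_polyVecDeg x j) ?_⟩
    simp [hi, h]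
  · exact ⟨i, h, hi.symm⟩

lemma polyVecDeg_map_C_mulVec_le (S : Matrix γ' γ F) (x : γ → F[X]) :
    polyVecDeg (S.map C *ᵥ x) ≤ polyVecDeg x :=
  polyVecDeg_le fun _ => natDegree_sum_le_of_forall_le _ _ fun j _ =>
    (natDegree_C_mul_le _ _).trans (natDegree_le_polyVecDeg x j)

lemma polyVecDeg_C_mul {α : F} (hα : α ≠ 0) (x : γ → F[X]) :
    polyVecDeg (fun i => C α * x i) = polyVecDeg x := by
  simp only [polyVecDeg, natDegree_C_mul hα]

lemma Lam_mulVec (x : Fin n → F[X]) :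
    Lam F k n *ᵥ x = fun p => X ^ (k - 1 - (p.1 : ℕ)) * x p.2 := by
  ext1 p
  simp [Matrix.mulVec, dotProduct, Lam]

lemma polyVecDeg_Lam_mulVec (hk : 0 < k) {x : Fin n → F[X]} (hx : x ≠ 0) :
    polyVecDeg (Lam F k n *ᵥ x) = polyVecDeg x + (k - 1) := by
  rw [Lam_mulVec]
  apply le_antisymm
  · refine polyVecDeg_le fun p => natDegree_mul_le.trans ?_
    have := natDegree_le_polyVecDeg x p.2
    rw [natDegree_X_pow]
    omega
  · obtain ⟨i, hi, hdeg⟩ := exists_natDegree_eq_polyVecDeg hx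
    rw [← hdeg]
    have := natDegree_le_polyVecDeg (fun p : Fin k × Fin n => X ^ (k - 1 - (p.1 : ℕ)) * x p.2)
      (⟨0, hk⟩, i)
    simpa [natDegree_X_pow_mul _ hi] using this

lemma polyVecDeg_inr_le_of_mulVec_eq_zero {U₁ U₀ : Matrix (Fin m) (Fin k × Fin n) F}
    {w : Fin m ⊕ (Fin (k - 1) × Fin n) → F[X]}
    (hw : (Matrix.fromRows (pencil U₁ U₀) (pencil (Hlam F k n) (Hconst F k n)))ᵀ *ᵥ w = 0) :
    polyVecDeg (fun s => w (Sum.inr s)) ≤ polyVecDeg fun r => w (Sum.inl r) := by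
  set a : Fin m → F[X] := fun r => w (Sum.inl r)
  set b : Fin (k - 1) × Fin n → F[X] := fun s => w (Sum.inr s)
  by_cases hb : b = 0
  · exact polyVecDeg_le fun s => by simp [hb]
  obtain ⟨s, hs, hdeg⟩ := exists_natDegree_eq_polyVecDeg hb
  by_contra! hlt
  let q : Fin k × Fin n := (⟨s.1 + 1, by omega⟩, s.2)
  have hlam : ∀ t, Hlam F k n t q = if t = s then 1 else 0 := by
    intro t
    simp only [Hlam, Matrix.of_apply, q, Prod.ext_iff, Fin.ext_iff]
    congr 1
    simp only [eq_iff_iff]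
    omega
  have hcol : X * b s + ∑ t, C (Hconst F k n t q) * b t + ∑ r, pencil U₁ U₀ r q * a r = 0 := by
    have h := congrFun hw q
    simp only [Matrix.mulVec, dotProduct, Fintype.sum_sum_type, Matrix.transpose_apply,
      Matrix.fromRows_apply_inl, Matrix.fromRows_apply_inr, Pi.zero_apply] at h
    rw [← h, add_comm]
    congr 1
    simp only [pencil, Matrix.of_apply, add_mul, Finset.sum_add_distrib, hlam]
    congr 1
    simp [apply_ite C, b]
  have hconst : (∑ t, C (Hconst F k n t q) * b t).natDegree ≤ polyVecDeg b :=
    natDegree_sum_le_of_forall_le _ _ fun t _ =>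
      (natDegree_C_mul_le _ _).trans (natDegree_le_polyVecDeg b t)
  have hU : (∑ r, pencil U₁ U₀ r q * a r).natDegree ≤ polyVecDeg b :=
    natDegree_sum_le_of_forall_le _ _ fun r _ => natDegree_mul_le.trans <| by
      have h₁ := natDegree_pencil_le U₁ U₀ r q
      have h₂ := natDegree_le_polyVecDeg a r
      omega
  have hX : (X * b s).natDegree = polyVecDeg b + 1 := by rw [natDegree_X_mul hs, hdeg]
  rw [add_assoc, add_eq_zero_iff_eq_neg] at hcol
  have := natDegree_add_le_of_degree_le hconst hU
  rw [hcol, natDegree_neg] at hX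
  omega

lemma polyVecDeg_eq_of_mulVec_eq_zero {U₁ U₀ : Matrix (Fin m) (Fin k × Fin n) F}
    {w : Fin m ⊕ (Fin (k - 1) × Fin n) → F[X]}
    (hw : (Matrix.fromRows (pencil U₁ U₀) (pencil (Hlam F k n) (Hconst F k n)))ᵀ *ᵥ w = 0) :
    (polyVecDeg fun r => w (Sum.inl r)) = polyVecDeg w := by
  apply le_antisymm
  · exact polyVecDeg_le fun r => natDegree_le_polyVecDeg w _
  · refine polyVecDeg_le ?_
    rintro (r | s)
    · exact natDegree_le_polyVecDeg (fun r => w (Sum.inl r)) r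
    · exact (natDegree_le_polyVecDeg (fun s => w (Sum.inr s)) s).trans
        (polyVecDeg_inr_le_of_mulVec_eq_zero hw)

lemma smul_mul_topInl_transpose_mulVec {μ σ : Type*} [Fintype μ] [DecidableEq μ] [Fintype σ]
    (N : Matrix (μ ⊕ σ) (μ ⊕ σ) F) (α : F) (y : μ ⊕ σ → F[X]) :
    (C α • (N.map C * topInl F μ σ))ᵀ *ᵥ y =
      fun r => C α * ((N.map C)ᵀ *ᵥ y) (Sum.inl r) := by
  ext1 r
  have htop : (N.map C * topInl F μ σ)ᵀ *ᵥ y = fun r => ((N.map C)ᵀ *ᵥ y) (Sum.inl r) := by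
    rw [Matrix.transpose_mul, ← Matrix.mulVec_mulVec, Matrix.transpose_fromRows,
      Matrix.transpose_one, Matrix.transpose_zero]
    ext1 r
    rw [Matrix.fromCols_mulVec, Matrix.one_mulVec, Matrix.zero_mulVec, add_zero]
    rfl
  rw [Matrix.transpose_smul, Matrix.smul_mulVec, htop]
  rfl

lemma polyVecDeg_leftMap
    {N N' : Matrix (Fin m ⊕ (Fin (k - 1) × Fin n)) (Fin m ⊕ (Fin (k - 1) × Fin n)) F}
    (hN : N' * N = 1) {U₁ U₀ : Matrix (Fin m) (Fin k × Fin n) F} {α : F} (hα : α ≠ 0)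
    {y : Fin m ⊕ (Fin (k - 1) × Fin n) → F[X]}
    (hy : (N.map C *
      Matrix.fromRows (pencil U₁ U₀) (pencil (Hlam F k n) (Hconst F k n)))ᵀ *ᵥ y = 0) :
    polyVecDeg ((C α • (N.map C * topInl F (Fin m) (Fin (k - 1) × Fin n)))ᵀ *ᵥ y) =
      polyVecDeg y := by
  rw [Matrix.transpose_mul, ← Matrix.mulVec_mulVec] at hy
  rw [smul_mul_topInl_transpose_mulVec, polyVecDeg_C_mul hα, polyVecDeg_eq_of_mulVec_eq_zero hy]
  apply le_antisymm
  · exact polyVecDeg_map_C_mulVec_le Nᵀ y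
  · have h1 : (N'ᵀ.map C : Matrix _ _ F[X]) * (N.map C)ᵀ = 1 := by
      rw [← Matrix.transpose_map, ← Matrix.map_mul, ← Matrix.transpose_mul, mul_eq_one_comm.1 hN]
      simp
    calc polyVecDeg y = polyVecDeg (N'ᵀ.map C *ᵥ ((N.map C)ᵀ *ᵥ y)) := by
          rw [Matrix.mulVec_mulVec, h1, Matrix.one_mulVec]
      _ ≤ _ := polyVecDeg_map_C_mulVec_le N'ᵀ _

lemma LvPoly_eq {ρ : Type*} [Fintype ρ] {D : Matrix ρ (Fin k × Fin m) F} {v : Fin k → F}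
    {W : Matrix ρ (Fin m) F} (h : ∀ s r, ∑ i, D s (i, r) * v i = W s r) (y : ρ → F[X]) :
    (LvPoly v fun p => ∑ s, C (D s p) * y s) = fun r => ∑ s, C (W s r) * y s := by
  ext1 r
  simp only [LvPoly, Finset.mul_sum]
  rw [Finset.sum_comm]
  refine Finset.sum_congr rfl fun s _ => ?_
  rw [← h, map_sum, Finset.sum_mul]
  refine Finset.sum_congr rfl fun i _ => ?_
  rw [C_mul]
  ring

lemma pencil_fromRows {μ σ τ : Type*} (U₁ U₀ : Matrix μ τ F) (H₁ H₀ : Matrix σ τ F) :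
    pencil (Matrix.fromRows U₁ H₁) (Matrix.fromRows U₀ H₀) =
      Matrix.fromRows (pencil U₁ U₀) (pencil H₁ H₀) := by
  ext1 (i | i) j <;> rfl

end Degree

/-- Let `m ≥ n`, `nrank P = r`, and let `L = λX + Y ∈ 𝕃₁(P)` have
nonzero right ansatz vector `v` and full `Z`-rank. Let `M` be nonsingular with
`Mv = αe₁` (`α ≠ 0`), let `Z = Q [R̃ ; 0]` be a QR decomposition of the `Z`-matrix
(`Q` unitary, `R̃` nonsingular upper triangular), and let `D` be admissible, i.e. the
matrix `[D ; [0 ∣ Q₂*](M ⊗ I_m)]` is nonsingular. Then the trimmed pencil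
`L_t(λ) = D L(λ)` is a strong linearization of `P(λ)` satisfying the four recovery
properties (a)–(d). -/
theorem statement_13 {F : Type*} [RCLike F] {k m n : ℕ} (hk : 0 < k) (hmn : n ≤ m)
    (r : ℕ) (A : Fin (k + 1) → Matrix (Fin m) (Fin n) F)
    (hr : nrank (matPoly A) = r)
    (Xc Yc : Matrix (Fin k × Fin m) (Fin k × Fin n) F)
    (v : Fin k → F) (hv : v ≠ 0)
    (hL : RightAnsatz (matPoly A) (pencil Xc Yc) v)
    (M : Matrix (Fin k) (Fin k) F) (hM : IsUnit M)
    (α : F) (hα : α ≠ 0) (hMv : M.mulVec v = e1 α)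
    (hrank : (Zmat1 M Yc).rank = (k - 1) * n)
    (Q : Matrix (Fin (k - 1) × Fin m)
      ((Fin (k - 1) × Fin n) ⊕ Fin ((k - 1) * (m - n))) F)
    (hQl : Qᴴ * Q = 1) (hQr : Q * Qᴴ = 1)
    (R : Matrix (Fin (k - 1) × Fin n) (Fin (k - 1) × Fin n) F)
    (hR : IsUnit R)
    (hRtri : ∀ p q : Fin (k - 1) × Fin n,
      (q.1 : ℕ) * n + (q.2 : ℕ) < (p.1 : ℕ) * n + (p.2 : ℕ) → R p q = 0)
    (hQR : Zmat1 M Yc = Q * Matrix.of (Sum.elim (fun p q => R p q) (fun _ _ => 0)))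
    (D : Matrix (Fin m ⊕ (Fin (k - 1) × Fin n)) (Fin k × Fin m) F)
    (hD : ∃ B : Matrix (Fin k × Fin m)
        ((Fin m ⊕ (Fin (k - 1) × Fin n)) ⊕ Fin ((k - 1) * (m - n))) F,
      trimAux M Q D * B = 1 ∧ B * trimAux M Q D = 1) :
    IsStrongLin ((k - 1) * n) A (pencil (D * Xc) (D * Yc)) ∧
    (∀ b : Fin (n - r) → (Fin k × Fin n → F[X]),
      IsMinimalBasis (Nr (pencil (D * Xc) (D * Yc))) b →
        ∃ x : Fin (n - r) → (Fin n → F[X]),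
          IsMinimalBasis (Nr (matPoly A)) x ∧
            ∀ i, b i = fun p => Polynomial.X ^ (k - 1 - (p.1 : ℕ)) * x i p.2) ∧
    (∀ ε : Fin (n - r) → ℕ,
      HasMinIndices (Nr (matPoly A)) ε ↔
        HasMinIndices (Nr (pencil (D * Xc) (D * Yc))) fun i => ε i + (k - 1)) ∧
    (∀ z : Fin (m - r) → (Fin m → F[X]),
      IsMinimalBasis (Nl (matPoly A)) z →
        ∃ y : Fin (m - r) → ((Fin m ⊕ (Fin (k - 1) × Fin n)) → F[X]),
          IsMinimalBasis (Nl (pencil (D * Xc) (D * Yc))) y ∧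
            ∀ i, z i = LvPoly v fun p => ∑ s, Polynomial.C (D s p) * y i s) ∧
    (∀ δ : Fin (m - r) → ℕ,
      HasMinIndices (Nl (matPoly A)) δ ↔
        HasMinIndices (Nl (pencil (D * Xc) (D * Yc))) δ) := by
  obtain ⟨B, -, hB⟩ := hD
  obtain ⟨N, N', U₁, U₀, hN, hX, hY, hU, hDv⟩ :=
    exists_trim_factorization hk hL hM hMv hQl hR hQR hB
  have hNC : (N'.map C : Matrix _ _ F[X]) * N.map C = 1 := by
    rw [← Matrix.map_mul, hN]
    simp
  have haa : C α⁻¹ * C α = (1 : F[X]) := by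
    rw [← C_mul, inv_mul_cancel₀ hα, C_1]
  have hfac : pencil (D * Xc) (D * Yc) = N.map C *
      Matrix.fromRows (pencil U₁ U₀) (pencil (Hlam F k n) (Hconst F k n)) := by
    rw [hX, hY, ← map_mul_pencil, pencil_fromRows]
  have hfacRev : revMat 1 (pencil (D * Xc) (D * Yc)) = N.map C *
      Matrix.fromRows (pencil U₀ U₁) (pencil (Hconst F k n) (Hlam F k n)) := by
    rw [revMat_pencil, hX, hY, ← map_mul_pencil, pencil_fromRows]
  have hr' := nullEquiv_right (blockInverse_shift hk) hU haa hNC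
  have hl' := nullEquiv_left (blockInverse_shift hk) hU haa hNC
  have hdegr : ∀ x : Fin n → F[X], x ≠ 0 → matPoly A *ᵥ x = 0 →
      polyVecDeg (Lam F k n *ᵥ x) = polyVecDeg x + (k - 1) :=
    fun x hx _ => polyVecDeg_Lam_mulVec hk hx
  have hdegl := fun (y : Fin m ⊕ (Fin (k - 1) × Fin n) → F[X]) (_ : y ≠ 0) hy =>
    polyVecDeg_leftMap hN (U₁ := U₁) (U₀ := U₀) hα (y := y) hy
  have hmap : ∀ y : Fin m ⊕ (Fin (k - 1) × Fin n) → F[X],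
      (C α • (N.map C * topInl F (Fin m) (Fin (k - 1) × Fin n)))ᵀ *ᵥ y =
        LvPoly v fun p => ∑ s, C (D s p) * y s := by
    intro y
    rw [smul_mul_topInl_transpose_mulVec,
      LvPoly_eq (W := Matrix.of fun s r => α * N s (Sum.inl r)) hDv]
    ext1 r
    simp only [Matrix.mulVec, dotProduct, Finset.mul_sum, Matrix.of_apply, Matrix.transpose_apply,
      Matrix.map_apply, C_mul, mul_assoc]
  refine ⟨⟨?_, ?_⟩, ?_, ?_, ?_, ?_⟩
  · rw [hfac]
    exact isLin_of_blockInverse (blockInverse_shift hk) (card_block hk) (by simp) hU haa hNC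
  · rw [hfacRev]
    exact isLin_of_blockInverse (blockInverse_shiftRev hk) (card_block hk) (by simp)
      (pencil_mul_LamRev hk hU) haa hNC
  · intro b hb
    rw [hfac] at hb
    refine ⟨_, hr'.isMinimalBasis_inv hdegr hb, fun i => ?_⟩
    rw [← Lam_mulVec, hr'.symm.mulVec_mulVec_poly (hb.1.mem i)]
  · intro ε
    rw [hfac]
    exact hr'.hasMinIndices_iff hdegr ε
  · intro z hz
    rw [hfac]
    refine ⟨_, hl'.isMinimalBasis_inv (c := 0) hdegl hz, fun i => ?_⟩
    rw [← hmap, hl'.symm.mulVec_mulVec_poly (hz.1.mem i)]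
  · intro δ
    rw [hfac]
    exact (hl'.hasMinIndices_iff (c := 0) hdegl δ).symm
end GLin
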